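/- The continuous map V_0 = U_0 ∘ P : 𝕋⁴ → U(2) is not homotopic, through continuous maps from 𝕋⁴ into U(2), to any constant map. -/

import Mathlib

open scoped ComplexConjugate unitInterval
noncomputable section

/-- The 4-torus `ℝ⁴/(2ℤ)⁴`, so that the cube `[−1, 1]⁴` maps onto it. -/
abbrev Torus4 : Type := Fin 4 → AddCircle (2 : ℝ)

/-- The quotient map `π : ℝ⁴ → 𝕋⁴ = ℝ⁴/(2ℤ)⁴`. -/
def qmap (u : Fin 4 → ℝ) : Torus4 := fun i => ((u i : ℝ) : AddCircle (2 : ℝ))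

/-- The standard identification of `ℝ⁴` with `ℂ²`. -/
def toC2 (u : Fin 4 → ℝ) : Fin 2 → ℂ :=
  ![(u 0 : ℂ) + (u 1 : ℂ) * Complex.I, (u 2 : ℂ) + (u 3 : ℂ) * Complex.I]

/-- The matrix `U_0(v, r) = I_2 − 2(1 + ir)^{-2} v v*`. -/
def U0mat (v : Fin 2 → ℂ) (r : ℝ) : Matrix (Fin 2) (Fin 2) ℂ :=
  Matrix.of fun j k =>
    (if j = k then (1 : ℂ) else 0) - 2 * ((1 + Complex.I * r) ^ 2)⁻¹ * v j * conj (v k)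

section ApproximateInvariance

variable {𝓗 : Type*} [NormedAddCommGroup 𝓗] [InnerProductSpace ℂ 𝓗] {ι : Type*} [Fintype ι]

/-- The linear combination `∑ c_a e_a`. -/
def synth (e : ι → 𝓗) (c : ι → ℂ) : 𝓗 := ∑ a, c a • e a

lemma synth_add (e : ι → 𝓗) (c d : ι → ℂ) : synth e (c + d) = synth e c + synth e d := by
  simp [synth, add_smul, Finset.sum_add_distrib]

lemma synth_smul (e : ι → 𝓗) (s : ℂ) (c : ι → ℂ) : synth e (s • c) = s • synth e c := by
  simp [synth, mul_smul, Finset.smul_sum]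

lemma synth_zero (e : ι → 𝓗) : synth e 0 = 0 := by simp [synth]

lemma synth_sum (e : ι → 𝓗) {κ : Type*} (s : Finset κ) (c : κ → ι → ℂ) :
    synth e (∑ k ∈ s, c k) = ∑ k ∈ s, synth e (c k) := by
  classical
  induction s using Finset.induction_on with
  | empty => simp [synth_zero]
  | insert a s ha ih => rw [Finset.sum_insert ha, Finset.sum_insert ha, synth_add, ih]

/-- The matrix `B` describes, up to an error `ε`, the action of `L` on the span of `e`. -/
def Approx (e : ι → 𝓗) (ε : ℝ) (L : 𝓗 →L[ℂ] 𝓗) (B : Matrix ι ι ℂ) : Prop :=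
  ∀ c : ι → ℂ, ‖L (synth e c) - synth e (B.mulVec c)‖ ≤ ε * ‖synth e c‖

variable {e : ι → 𝓗} {ε ε' : ℝ} {L L' : 𝓗 →L[ℂ] 𝓗} {B B' : Matrix ι ι ℂ}

lemma Approx.mono (h : Approx e ε L B) (hε : ε ≤ ε') : Approx e ε' L B := fun c =>
  (h c).trans (mul_le_mul_of_nonneg_right hε (norm_nonneg _))

lemma Approx.add (h : Approx e ε L B) (h' : Approx e ε' L' B') :
    Approx e (ε + ε') (L + L') (B + B') := fun c => by
  have : (L + L') (synth e c) - synth e ((B + B').mulVec c) =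
      (L (synth e c) - synth e (B.mulVec c)) + (L' (synth e c) - synth e (B'.mulVec c)) := by
    rw [Matrix.add_mulVec, synth_add, _root_.add_apply]; abel
  rw [this, add_mul]
  exact (norm_add_le _ _).trans (add_le_add (h c) (h' c))

lemma Approx.smul (h : Approx e ε L B) (s : ℂ) : Approx e (‖s‖ * ε) (s • L) (s • B) := fun c => by
  have : (s • L) (synth e c) - synth e ((s • B).mulVec c) =
      s • (L (synth e c) - synth e (B.mulVec c)) := by
    rw [Matrix.smul_mulVec, synth_smul, _root_.smul_apply, smul_sub]
  rw [this, norm_smul, mul_assoc]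
  exact mul_le_mul_of_nonneg_left (h c) (norm_nonneg _)

lemma Approx.mul (h : Approx e ε L B) (h' : Approx e ε' L' B') (hε : 0 ≤ ε) :
    Approx e (‖L‖ * ε' + ε * (‖L'‖ + ε')) (L * L') (B * B') := fun c => by
  have h1 : (L * L') (synth e c) - synth e ((B * B').mulVec c) =
      L (L' (synth e c) - synth e (B'.mulVec c)) +
        (L (synth e (B'.mulVec c)) - synth e (B.mulVec (B'.mulVec c))) := by
    rw [Matrix.mulVec_mulVec, map_sub, mul_apply_eq_comp]; abel
  have h2 : ‖synth e (B'.mulVec c)‖ ≤ (‖L'‖ + ε') * ‖synth e c‖ := by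
    have := norm_sub_norm_le (synth e (B'.mulVec c)) (L' (synth e c))
    rw [norm_sub_rev] at this
    have h3 := L'.le_opNorm (synth e c)
    have h4 := h' c
    linarith
  rw [h1]
  refine (norm_add_le _ _).trans ?_
  have h3 := (L.le_opNorm (L' (synth e c) - synth e (B'.mulVec c))).trans
    (mul_le_mul_of_nonneg_left (h' c) (norm_nonneg _))
  have h4 := (h (B'.mulVec c)).trans (mul_le_mul_of_nonneg_left h2 hε)
  linarith

lemma Approx.perturb (h : Approx e ε L B) : Approx e (ε + ‖L' - L‖) L' B := fun c => by
  have : L' (synth e c) - synth e (B.mulVec c) =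
      (L (synth e c) - synth e (B.mulVec c)) + (L' - L) (synth e c) := by
    rw [_root_.sub_apply]; abel
  rw [this, add_mul]
  exact (norm_add_le _ _).trans (add_le_add (h c) ((L' - L).le_opNorm _))

lemma Approx.one [DecidableEq ι] : Approx e 0 (1 : 𝓗 →L[ℂ] 𝓗) 1 := fun c => by simp

lemma Approx.convex (h : Approx e ε L B) (h' : Approx e ε L B') {s : ℝ} (hs : s ∈ Set.Icc (0:ℝ) 1) :
    Approx e ε L (((1 - s : ℝ) : ℂ) • B + ((s : ℝ) : ℂ) • B') := by
  have := (h.smul ((1 - s : ℝ) : ℂ)).add (h'.smul ((s : ℝ) : ℂ))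
  rw [← add_smul, ← Complex.ofReal_add] at this
  simp only [Complex.norm_real, Real.norm_eq_abs, abs_of_nonneg hs.1,
    abs_of_nonneg (sub_nonneg.2 hs.2), sub_add_cancel, Complex.ofReal_one, one_smul] at this
  convert this using 1
  ring

/-- The compression of an operator to the span of an orthogonal family. -/
def compress (e : ι → 𝓗) (L : 𝓗 →L[ℂ] 𝓗) : Matrix ι ι ℂ :=
  Matrix.of fun a b => inner ℂ (e a) (L (e b)) / ((‖e a‖ ^ 2 : ℝ) : ℂ)

lemma inner_synth (horth : ∀ a b, a ≠ b → inner ℂ (e a) (e b) = 0) (a : ι) (c : ι → ℂ) :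
    inner ℂ (e a) (synth e c) = c a * ((‖e a‖ ^ 2 : ℝ) : ℂ) := by
  classical
  rw [synth, inner_sum, Finset.sum_eq_single a]
  · rw [inner_smul_right, inner_self_eq_norm_sq_to_K]; simp
  · intro b _ hb; rw [inner_smul_right, horth a b hb.symm, mul_zero]
  · simp

lemma synth_eq_zero (horth : ∀ a b, a ≠ b → inner ℂ (e a) (e b) = 0) (hne : ∀ a, e a ≠ 0)
    {c : ι → ℂ} (h : synth e c = 0) : c = 0 := by
  funext a
  have := inner_synth horth a c
  rw [h, inner_zero_right] at this
  simpa [hne a] using this.symm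

lemma Approx.compress (horth : ∀ a b, a ≠ b → inner ℂ (e a) (e b) = 0) (hne : ∀ a, e a ≠ 0)
    (h : Approx e ε L B) : Approx e ε L (compress e L) := fun c => by
  refine le_trans ?_ (h c)
  set p := synth e ((_root_.compress e L).mulVec c)
  have key : ∀ a, inner ℂ (e a) (L (synth e c) - p) = 0 := by
    intro a
    rw [inner_sub_right, inner_synth horth, sub_eq_zero]
    have hn : ((‖e a‖ ^ 2 : ℝ) : ℂ) ≠ 0 := by
      exact_mod_cast pow_ne_zero 2 (norm_ne_zero_iff.2 (hne a))
    simp only [Matrix.mulVec, dotProduct, _root_.compress, Matrix.of_apply, Finset.sum_mul]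
    rw [synth, map_sum, inner_sum]
    refine Finset.sum_congr rfl fun b _ => ?_
    rw [map_smul, inner_smul_right]
    field_simp
  have key2 : ∀ d, inner ℂ (synth e d) (L (synth e c) - p) = 0 := by
    intro d
    rw [synth, sum_inner]
    exact Finset.sum_eq_zero fun a _ => by rw [inner_smul_left, key, mul_zero]
  have h1 : L (synth e c) - synth e (B.mulVec c) =
      synth e ((_root_.compress e L).mulVec c - B.mulVec c) + (L (synth e c) - p) := by
    rw [sub_eq_add_neg ((_root_.compress e L).mulVec c), synth_add,
      ← neg_one_smul ℂ (B.mulVec c), synth_smul, neg_one_smul]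
    simp only [p]
    abel
  rw [h1]
  have := norm_add_sq_eq_norm_sq_add_norm_sq_of_inner_eq_zero _ _
    (key2 ((_root_.compress e L).mulVec c - B.mulVec c))
  nlinarith [norm_nonneg (synth e ((_root_.compress e L).mulVec c - B.mulVec c) + (L (synth e c) - p)),
    norm_nonneg (L (synth e c) - p), norm_nonneg (synth e ((_root_.compress e L).mulVec c - B.mulVec c))]

/-- The matrix with blocks `B k l`. -/
def blockMatrix (B : Fin 2 → Fin 2 → Matrix ι ι ℂ) : Matrix (Fin 2 × ι) (Fin 2 × ι) ℂ :=
  Matrix.of fun p q => B p.1 q.1 p.2 q.2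

lemma det_blockMatrix_ne_zero [DecidableEq ι] (horth : ∀ a b, a ≠ b → inner ℂ (e a) (e b) = 0)
    (hne : ∀ a, e a ≠ 0) {F F' : Fin 2 → Fin 2 → 𝓗 →L[ℂ] 𝓗}
    (hF : ∀ m l, ∑ k, F' m k * F k l = if m = l then 1 else 0) {C : ℝ} (hC : ∀ m k, ‖F' m k‖ ≤ C)
    (hε : 4 * C * ε < 1) {B : Fin 2 → Fin 2 → Matrix ι ι ℂ} (hB : ∀ k l, Approx e ε (F k l) (B k l)) :
    (blockMatrix B).det ≠ 0 := by
  intro hdet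
  obtain ⟨c, hc, hMc⟩ := Matrix.exists_mulVec_eq_zero_iff.2 hdet
  apply hc
  set ψ : Fin 2 → 𝓗 := fun l => synth e fun a => c (l, a) with hψ
  have h0 : ∀ k, ∑ l, synth e ((B k l).mulVec fun a => c (l, a)) = 0 := by
    intro k
    rw [← synth_sum]
    convert synth_zero e
    funext a
    have := congrFun hMc (k, a)
    rw [Matrix.mulVec, dotProduct, Fintype.sum_prod_type] at this
    simpa [Finset.sum_apply, Matrix.mulVec, dotProduct, blockMatrix] using this
  have h1 : ∀ k, ‖∑ l, F k l (ψ l)‖ ≤ ε * ∑ l, ‖ψ l‖ := by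
    intro k
    have : ∑ l, F k l (ψ l) = ∑ l, (F k l (ψ l) - synth e ((B k l).mulVec fun a => c (l, a))) := by
      rw [Finset.sum_sub_distrib, h0, sub_zero]
    rw [this, Finset.mul_sum]
    exact (norm_sum_le _ _).trans (Finset.sum_le_sum fun l _ => hB k l _)
  have h2 : ∀ m, ψ m = ∑ k, F' m k (∑ l, F k l (ψ l)) := by
    intro m
    have : ∑ k, F' m k (∑ l, F k l (ψ l)) = ∑ l, (∑ k, F' m k * F k l) (ψ l) := by
      simp only [map_sum, _root_.sum_apply, mul_apply_eq_comp]
      exact Finset.sum_comm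
    rw [this, Finset.sum_eq_single m]
    · simp [hF]
    · intro b _ hb; simp [hF, hb.symm]
    · simp
  have h3 : ∀ m, ‖ψ m‖ ≤ 2 * C * ε * ∑ l, ‖ψ l‖ := by
    intro m
    have hk : ∀ k ∈ Finset.univ, ‖F' m k (∑ l, F k l (ψ l))‖ ≤ C * (ε * ∑ l, ‖ψ l‖) := fun k _ =>
      ((F' m k).le_opNorm _).trans
        (mul_le_mul (hC m k) (h1 k) (norm_nonneg _) ((norm_nonneg _).trans (hC m k)))
    have := (norm_sum_le _ _).trans (Finset.sum_le_sum hk)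
    rw [← h2 m] at this
    simp at this
    rw [Fin.sum_univ_two]
    linarith
  have h4 : ∀ l, ψ l = 0 := by
    have h5 := h3 0
    have h6 := h3 1
    rw [Fin.sum_univ_two] at h5 h6
    have h7 := norm_nonneg (ψ 0)
    have h8 := norm_nonneg (ψ 1)
    have h9 : ‖ψ 0‖ + ‖ψ 1‖ = 0 := by
      by_contra hne
      have : 0 < ‖ψ 0‖ + ‖ψ 1‖ := lt_of_le_of_ne (by positivity) (Ne.symm hne)
      nlinarith
    intro l
    rw [← norm_eq_zero]
    fin_cases l <;> simp only [Fin.zero_eta, Fin.mk_one] <;> linarith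
  funext p
  exact congrFun (synth_eq_zero horth hne (h4 p.1)) p.2

end ApproximateInvariance

section Quantization

open Filter Topology

variable {X : Type*} [TopologicalSpace X]
  {𝓗 : Type*} [NormedAddCommGroup 𝓗] [InnerProductSpace ℂ 𝓗]
  (ρ : C(X, ℂ) →ₐ[ℂ] (𝓗 →L[ℂ] 𝓗)) {ι : ℕ → Type*} [∀ n, Fintype (ι n)] (e : ∀ n, ι n → 𝓗)

/-- The matrices `B n` describe asymptotically the action of `ρ g` on the span of `e n`. -/
def Quantizes (g : C(X, ℂ)) (B : ∀ n, Matrix (ι n) (ι n) ℂ) : Prop :=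
  ∀ ε : ℝ, 0 < ε → ∀ᶠ n in atTop, Approx (e n) ε (ρ g) (B n)

variable {ρ e} {g g' : C(X, ℂ)} {B B' : ∀ n, Matrix (ι n) (ι n) ℂ}

lemma Quantizes.add (h : Quantizes ρ e g B) (h' : Quantizes ρ e g' B') :
    Quantizes ρ e (g + g') (fun n => B n + B' n) := fun ε hε => by
  filter_upwards [h (ε / 2) (half_pos hε), h' (ε / 2) (half_pos hε)] with n h1 h2
  rw [map_add]
  exact (h1.add h2).mono (by linarith)

lemma Quantizes.smul (h : Quantizes ρ e g B) (s : ℂ) :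
    Quantizes ρ e (s • g) (fun n => s • B n) := fun ε hε => by
  filter_upwards [h (ε / (‖s‖ + 1)) (by positivity)] with n h1
  rw [map_smul]
  refine (h1.smul s).mono ?_
  rw [← mul_div_assoc, div_le_iff₀ (by positivity)]
  nlinarith [norm_nonneg s]

lemma Quantizes.sub (h : Quantizes ρ e g B) (h' : Quantizes ρ e g' B') :
    Quantizes ρ e (g - g') (fun n => B n - B' n) := by
  have := h.add (h'.smul (-1))
  simpa only [neg_one_smul ℂ g', neg_one_smul ℂ, ← sub_eq_add_neg] using this

lemma Quantizes.mul (h : Quantizes ρ e g B) (h' : Quantizes ρ e g' B') :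
    Quantizes ρ e (g * g') (fun n => B n * B' n) := fun ε hε => by
  obtain ⟨δ, hδ, hδ1, hδε⟩ : ∃ δ : ℝ, 0 < δ ∧ δ ≤ 1 ∧ δ * (‖ρ g‖ + ‖ρ g'‖ + 1) ≤ ε := by
    refine ⟨min 1 (ε / (‖ρ g‖ + ‖ρ g'‖ + 1)), by positivity, min_le_left _ _, ?_⟩
    rw [← le_div_iff₀ (by positivity)]
    exact min_le_right _ _
  filter_upwards [h δ hδ, h' δ hδ] with n h1 h2
  rw [map_mul]
  refine (h1.mul h2 hδ.le).mono ?_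
  nlinarith

lemma quantizes_algebraMap [∀ n, DecidableEq (ι n)] (s : ℂ) :
    Quantizes ρ e (algebraMap ℂ _ s) (fun _ => s • 1) := fun ε hε => by
  refine Eventually.of_forall fun n => ?_
  rw [AlgHom.commutes, Algebra.algebraMap_eq_smul_one]
  exact ((Approx.one (e := e n)).smul s).mono (by simpa using hε.le)

/-- Continuous functions on a compact space are quantized by compressions as soon as this
holds for a separating family of functions. -/
lemma quantizes_compress [CompactSpace X] [T2Space X] (hρ : ∀ g, ‖ρ g‖ ≤ ‖g‖)
    (horth : ∀ n a b, a ≠ b → inner ℂ (e n a) (e n b) = 0) (hne : ∀ n a, e n a ≠ 0)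
    {S : Set C(X, ℂ)} (hS : ∀ g ∈ S, ∃ B, Quantizes ρ e g B) (hstar : ∀ g ∈ S, star g ∈ S)
    (hsep : ∀ x y : X, x ≠ y → ∃ g ∈ S, g x ≠ g y) (g : C(X, ℂ)) :
    Quantizes ρ e g (fun n => compress (e n) (ρ g)) := by
  classical
  have hadj : ∀ g ∈ StarAlgebra.adjoin ℂ S, ∃ B, Quantizes ρ e g B := by
    intro g hg
    have hg' : g ∈ Algebra.adjoin ℂ (S ∪ star S) := by
      rw [← StarAlgebra.adjoin_toSubalgebra]; exact hg
    have hU : S ∪ star S = S := by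
      refine Set.union_eq_left.2 fun x hx => ?_
      have := hstar _ hx
      rwa [star_star] at this
    rw [hU] at hg'
    induction hg' using Algebra.adjoin_induction with
    | mem x hx => exact hS x hx
    | algebraMap r => exact ⟨_, quantizes_algebraMap r⟩
    | add x y _ _ hx hy =>
      obtain ⟨B, hB⟩ := hx (by
        rwa [← StarSubalgebra.mem_toSubalgebra, StarAlgebra.adjoin_toSubalgebra, hU])
      obtain ⟨B', hB'⟩ := hy (by
        rwa [← StarSubalgebra.mem_toSubalgebra, StarAlgebra.adjoin_toSubalgebra, hU])
      exact ⟨_, hB.add hB'⟩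
    | mul x y _ _ hx hy =>
      obtain ⟨B, hB⟩ := hx (by
        rwa [← StarSubalgebra.mem_toSubalgebra, StarAlgebra.adjoin_toSubalgebra, hU])
      obtain ⟨B', hB'⟩ := hy (by
        rwa [← StarSubalgebra.mem_toSubalgebra, StarAlgebra.adjoin_toSubalgebra, hU])
      exact ⟨_, hB.mul hB'⟩
  have htop := ContinuousMap.starSubalgebra_topologicalClosure_eq_top_of_separatesPoints
    (StarAlgebra.adjoin ℂ S) (by
      intro x y hxy
      obtain ⟨f, hf, hfx⟩ := hsep x y hxy
      exact ⟨f, ⟨f, StarAlgebra.subset_adjoin ℂ S hf, rfl⟩, hfx⟩)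
  have hcl : g ∈ closure (StarAlgebra.adjoin ℂ S : Set C(X, ℂ)) := by
    rw [← StarSubalgebra.topologicalClosure_coe, htop]; trivial
  intro ε hε
  obtain ⟨g', hg', hd⟩ := Metric.mem_closure_iff.1 hcl (ε / 2) (half_pos hε)
  obtain ⟨B, hB⟩ := hadj g' hg'
  filter_upwards [hB (ε / 2) (half_pos hε)] with n hn
  refine Approx.compress (horth n) (hne n) ((hn.perturb (L' := ρ g)).mono ?_)
  rw [← map_sub]
  have := hρ (g - g')
  rw [dist_eq_norm] at hd
  linarith

lemma eventually_approx_of_isCompact [CompactSpace X] (hρ : ∀ g, ‖ρ g‖ ≤ ‖g‖)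
    (horth : ∀ n a b, a ≠ b → inner ℂ (e n a) (e n b) = 0) (hne : ∀ n a, e n a ≠ 0)
    (hq : ∀ g, Quantizes ρ e g (fun n => compress (e n) (ρ g)))
    {K : Set C(X, ℂ)} (hK : IsCompact K) {ε : ℝ} (hε : 0 < ε) :
    ∀ᶠ n in atTop, ∀ g ∈ K, Approx (e n) ε (ρ g) (compress (e n) (ρ g)) := by
  obtain ⟨s, -, hs, hcov⟩ := hK.finite_cover_balls (half_pos hε)
  have : ∀ᶠ n in atTop, ∀ g ∈ s, Approx (e n) (ε / 2) (ρ g) (compress (e n) (ρ g)) :=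
    (eventually_all_finite hs).2 fun g _ => hq g _ (half_pos hε)
  filter_upwards [this] with n hn g hg
  obtain ⟨g', hg', hd⟩ := Set.mem_iUnion₂.1 (hcov hg)
  refine Approx.compress (horth n) (hne n) (((hn g' hg').perturb (L' := ρ g)).mono ?_)
  rw [← map_sub]
  have := hρ (g - g')
  rw [Metric.mem_ball, dist_eq_norm] at hd
  linarith

lemma mul_pos_of_path {f : ℝ → ℂ} (hf : Continuous f) (h0 : ∀ s ∈ Set.Icc (0 : ℝ) 1, f s ≠ 0)
    (him : ∀ s ∈ Set.Icc (0 : ℝ) 1, (f s).im = 0) : 0 < (f 0).re * (f 1).re := by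
  by_contra hcon
  push Not at hcon
  have hc : ContinuousOn (fun s => (f s).re) (Set.Icc 0 1) :=
    (Complex.continuous_re.comp hf).continuousOn
  have : ∃ s ∈ Set.Icc (0 : ℝ) 1, (f s).re = 0 := by
    rcases mul_nonpos_iff.1 hcon with ⟨h1, h2⟩ | ⟨h1, h2⟩
    · obtain ⟨s, hs, h⟩ := intermediate_value_Icc' zero_le_one hc ⟨h2, h1⟩
      exact ⟨s, hs, h⟩
    · obtain ⟨s, hs, h⟩ := intermediate_value_Icc zero_le_one hc ⟨h1, h2⟩
      exact ⟨s, hs, h⟩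
  obtain ⟨s, hs, h⟩ := this
  exact h0 s hs (Complex.ext h (him s hs))

/-- The matrix of compressions of a matrix of functions. -/
def compressMatrix (ρ : C(X, ℂ) →ₐ[ℂ] (𝓗 →L[ℂ] 𝓗)) (e : ∀ n, ι n → 𝓗)
    (F : Fin 2 → Fin 2 → C(X, ℂ)) (n : ℕ) : Matrix (Fin 2 × ι n) (Fin 2 × ι n) ℂ :=
  blockMatrix fun k l => compress (e n) (ρ (F k l))

lemma continuous_compress [CompactSpace X] {Y κ : Type*} [TopologicalSpace Y] {G : Y → C(X, ℂ)}
    (hG : Continuous G) (hρ : ∀ g, ‖ρ g‖ ≤ ‖g‖) {f : κ → 𝓗} (a b : κ) :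
    Continuous fun y => compress f (ρ (G y)) a b := by
  have h1 : Continuous fun g => ρ g := AddMonoidHomClass.continuous_of_bound ρ 1
    fun g => by simpa using hρ g
  simp only [compress, Matrix.of_apply]
  refine Continuous.div_const ?_ _
  exact continuous_const.inner ((h1.comp hG).clm_apply continuous_const)

lemma det_compressMatrix_path [CompactSpace X] [∀ n, DecidableEq (ι n)] (hρ : ∀ g, ‖ρ g‖ ≤ ‖g‖)
    (horth : ∀ n a b, a ≠ b → inner ℂ (e n a) (e n b) = 0) (hne : ∀ n a, e n a ≠ 0)
    (hq : ∀ g, Quantizes ρ e g (fun n => compress (e n) (ρ g)))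
    {F F' : ℝ → Fin 2 → Fin 2 → C(X, ℂ)} (hF : ∀ k l, Continuous fun t => F t k l)
    (hF' : ∀ k l, Continuous fun t => F' t k l)
    (hinv : ∀ t ∈ Set.Icc (0 : ℝ) 1, ∀ m l, ∑ k, F' t m k * F t k l = if m = l then 1 else 0)
    (hreal : ∀ t ∈ Set.Icc (0 : ℝ) 1, ∀ n, (compressMatrix ρ e (F t) n).det.im = 0) :
    ∀ᶠ n in atTop,
      0 < (compressMatrix ρ e (F 0) n).det.re * (compressMatrix ρ e (F 1) n).det.re := by
  have hb : ∀ k l, ∃ C, ∀ t ∈ Set.Icc (0 : ℝ) 1, ‖F' t k l‖ ≤ C := fun k l =>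
    isCompact_Icc.exists_bound_of_continuousOn (hF' k l).continuousOn
  choose C hC using hb
  set D : ℝ := 1 + ∑ k, ∑ l, |C k l|
  have hDpos : 0 < D := by positivity
  have hD : ∀ t ∈ Set.Icc (0 : ℝ) 1, ∀ k l, ‖ρ (F' t k l)‖ ≤ D := by
    intro t ht k l
    have h1 := (hρ _).trans ((hC k l t ht).trans (le_abs_self _))
    have h2 : |C k l| ≤ ∑ l, |C k l| :=
      Finset.single_le_sum (f := fun l => |C k l|) (fun _ _ => abs_nonneg _) (Finset.mem_univ l)
    have h3 : ∑ l, |C k l| ≤ ∑ k, ∑ l, |C k l| :=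
      Finset.single_le_sum (f := fun k => ∑ l, |C k l|)
        (fun _ _ => Finset.sum_nonneg fun _ _ => abs_nonneg _) (Finset.mem_univ k)
    simp only [D]; linarith
  have hε : 0 < 1 / (8 * D) := by positivity
  have hev : ∀ᶠ n in atTop, ∀ k l, ∀ g ∈ (fun t => F t k l) '' Set.Icc (0 : ℝ) 1,
      Approx (e n) (1 / (8 * D)) (ρ g) (compress (e n) (ρ g)) :=
    eventually_all.2 fun k => eventually_all.2 fun l =>
      eventually_approx_of_isCompact hρ horth hne hq (isCompact_Icc.image (hF k l)) hε
  filter_upwards [hev] with n hn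
  refine mul_pos_of_path (f := fun t => (compressMatrix ρ e (F t) n).det) ?_ ?_
    fun t ht => hreal t ht n
  · refine Continuous.matrix_det (continuous_matrix fun p q => ?_)
    exact continuous_compress (hF _ _) hρ _ _
  · intro t ht
    refine det_blockMatrix_ne_zero (horth n) (hne n) (F := fun k l => ρ (F t k l))
      (F' := fun k l => ρ (F' t k l)) ?_ (hD t ht) (ε := 1 / (8 * D)) ?_
      fun k l => hn k l _ ⟨t, ht, rfl⟩
    · intro m l
      have := congrArg ρ (hinv t ht m l)
      rw [map_sum] at this
      simp only [map_mul] at this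
      rw [this]; split_ifs <;> simp
    · field_simp; norm_num

lemma det_compressMatrix_symbol [∀ n, DecidableEq (ι n)]
    (horth : ∀ n a b, a ≠ b → inner ℂ (e n a) (e n b) = 0) (hne : ∀ n a, e n a ≠ 0)
    {F F' : Fin 2 → Fin 2 → C(X, ℂ)}
    (hinv : ∀ m l, ∑ k, F' m k * F k l = if m = l then 1 else 0)
    {A : ∀ n, Fin 2 → Fin 2 → Matrix (ι n) (ι n) ℂ}
    (hA : ∀ k l, Quantizes ρ e (F k l) (fun n => A n k l))
    (hreal : ∀ s ∈ Set.Icc (0 : ℝ) 1, ∀ n, (((1 - s : ℝ) : ℂ) • compressMatrix ρ e F n +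
      ((s : ℝ) : ℂ) • blockMatrix (A n)).det.im = 0) :
    ∀ᶠ n in atTop, 0 < (compressMatrix ρ e F n).det.re * (blockMatrix (A n)).det.re := by
  set D : ℝ := 1 + ∑ k, ∑ l, ‖ρ (F' k l)‖
  have hDpos : 0 < D := by positivity
  have hD : ∀ k l, ‖ρ (F' k l)‖ ≤ D := by
    intro k l
    have h2 : ‖ρ (F' k l)‖ ≤ ∑ l, ‖ρ (F' k l)‖ :=
      Finset.single_le_sum (f := fun l => ‖ρ (F' k l)‖) (fun _ _ => norm_nonneg _) (Finset.mem_univ l)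
    have h3 : ∑ l, ‖ρ (F' k l)‖ ≤ ∑ k, ∑ l, ‖ρ (F' k l)‖ :=
      Finset.single_le_sum (f := fun k => ∑ l, ‖ρ (F' k l)‖)
        (fun _ _ => Finset.sum_nonneg fun _ _ => norm_nonneg _) (Finset.mem_univ k)
    simp only [D]; linarith
  have hε : 0 < 1 / (8 * D) := by positivity
  have hev : ∀ᶠ n in atTop, ∀ k l, Approx (e n) (1 / (8 * D)) (ρ (F k l)) (A n k l) :=
    eventually_all.2 fun k => eventually_all.2 fun l => hA k l _ hε
  filter_upwards [hev] with n hn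
  have := mul_pos_of_path (f := fun s => (((1 - s : ℝ) : ℂ) • compressMatrix ρ e F n +
      ((s : ℝ) : ℂ) • blockMatrix (A n)).det) ?_ ?_ fun t ht => hreal t ht n
  · simpa using this
  · refine Continuous.matrix_det ?_
    exact ((Complex.continuous_ofReal.comp (continuous_const.sub continuous_id)).smul
      continuous_const).add (Complex.continuous_ofReal.smul continuous_const)
  · intro s hs
    have h1 := det_blockMatrix_ne_zero (horth n) (hne n) (F := fun k l => ρ (F k l))
      (F' := fun k l => ρ (F' k l)) (ε := 1 / (8 * D)) ?_ hD ?_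
      fun k l => (Approx.compress (horth n) (hne n) (hn k l)).convex (hn k l) hs
    · convert h1 using 2
      ext p q; rfl
    · intro m l
      have := congrArg ρ (hinv m l)
      rw [map_sum] at this
      simp only [map_mul] at this
      rw [this]; split_ifs <;> simp
    · field_simp; norm_num

end Quantization

section GaussianMoments

open MeasureTheory Complex
open scoped NNReal

/-- The density of the standard Gaussian measure on `ℂ`. -/
def gaussDensity (z : ℂ) : ℝ≥0 := ⟨Real.exp (-‖z‖ ^ 2) / Real.pi, by positivity⟩

lemma coe_gaussDensity (z : ℂ) : (gaussDensity z : ℝ) = Real.exp (-‖z‖ ^ 2) / Real.pi := rfl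

/-- The standard Gaussian measure on `ℂ`. -/
def gaussC : Measure ℂ := volume.withDensity fun z => (gaussDensity z : ENNReal)

lemma measurable_gaussDensity : Measurable gaussDensity := by
  refine Measurable.subtype_mk ?_
  fun_prop

lemma integrable_norm_pow_mul_exp (k : ℕ) :
    Integrable fun z : ℂ => ‖z‖ ^ k * Real.exp (-‖z‖ ^ 2) := by
  have h := Complex.integral_rpow_mul_exp_neg_rpow (p := 2) (q := k) (by norm_num)
    (by have : (0 : ℝ) ≤ k := k.cast_nonneg
        linarith)
  have h2 : Integrable fun z : ℂ => ‖z‖ ^ (k : ℝ) * Real.exp (-‖z‖ ^ (2 : ℝ)) := by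
    refine Integrable.of_integral_ne_zero ?_
    rw [h]
    have : 0 < Real.Gamma ((k + 2) / 2) := Real.Gamma_pos_of_pos (by positivity)
    positivity
  simpa using h2

lemma integral_norm_pow_mul_exp (k : ℕ) :
    ∫ z : ℂ, ‖z‖ ^ (2 * k) * Real.exp (-‖z‖ ^ 2) = Real.pi * k.factorial := by
  have h := Complex.integral_rpow_mul_exp_neg_rpow (p := 2) (q := (2 * k : ℕ)) (by norm_num)
    (by have : (0 : ℝ) ≤ ((2 * k : ℕ) : ℝ) := Nat.cast_nonneg _
        linarith)
  rw [show (((2 * k : ℕ) : ℝ) + 2) / 2 = k + 1 by push_cast; ring, Real.Gamma_nat_eq_factorial] at h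
  convert h using 1
  · congr 1; funext z; congr 1
    · exact (Real.rpow_natCast _ _).symm
    · norm_num
  · ring

lemma integrable_gaussC (a b : ℕ) : Integrable (fun z : ℂ => z ^ a * conj z ^ b) gaussC := by
  rw [gaussC, integrable_withDensity_iff_integrable_smul measurable_gaussDensity]
  refine ((integrable_norm_pow_mul_exp (a + b)).div_const Real.pi).mono' ?_ ?_
  · refine (measurable_gaussDensity.smul ?_).aestronglyMeasurable
    fun_prop
  · refine Filter.Eventually.of_forall fun z => le_of_eq ?_
    rw [NNReal.smul_def, norm_smul]
    simp only [coe_gaussDensity, norm_mul, norm_pow, RCLike.norm_conj]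
    rw [Real.norm_of_nonneg (by positivity)]
    ring

lemma integral_gaussC (a b : ℕ) :
    ∫ z : ℂ, z ^ a * conj z ^ b ∂gaussC = if a = b then (a.factorial : ℂ) else 0 := by
  rw [gaussC, integral_withDensity_eq_integral_smul measurable_gaussDensity]
  split_ifs with h
  · subst h
    have h1 : ∀ z : ℂ, gaussDensity z • (z ^ a * conj z ^ a) =
        ((‖z‖ ^ (2 * a) * Real.exp (-‖z‖ ^ 2) / Real.pi : ℝ) : ℂ) := by
      intro z
      rw [← mul_pow, mul_conj, normSq_eq_norm_sq, NNReal.smul_def]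
      simp only [coe_gaussDensity, real_smul]
      push_cast
      ring
    simp_rw [h1]
    rw [integral_complex_ofReal, integral_div, integral_norm_pow_mul_exp,
      mul_div_cancel_left₀ _ Real.pi_ne_zero]
    simp
  · set θ : ℝ := Real.pi / ((a : ℝ) - b)
    have hab : (a : ℝ) - b ≠ 0 := sub_ne_zero.2 (by exact_mod_cast h)
    set w : Circle := Circle.exp θ
    have hw : (w : ℂ) ^ a * conj (w : ℂ) ^ b = -1 := by
      have : conj (w : ℂ) = Complex.exp (-(θ * Complex.I)) := by
        rw [Circle.coe_exp, ← Complex.exp_conj]; simp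
      rw [this, Circle.coe_exp, ← Complex.exp_nat_mul, ← Complex.exp_nat_mul, ← Complex.exp_add,
        show (a : ℂ) * (θ * Complex.I) + b * -(θ * Complex.I) =
          (((a : ℝ) - b) * θ : ℝ) * Complex.I by push_cast; ring,
        show ((a : ℝ) - b) * θ = Real.pi by simp only [θ]; field_simp, Complex.exp_pi_mul_I]
    have h1 := (rotation w).measurePreserving.integral_comp
      (rotation w).toHomeomorph.measurableEmbedding
      (fun z => gaussDensity z • (z ^ a * conj z ^ b))
    have h2 : ∀ z : ℂ, gaussDensity (rotation w z) • ((rotation w z) ^ a * conj (rotation w z) ^ b)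
        = -(gaussDensity z • (z ^ a * conj z ^ b)) := by
      intro z
      have : gaussDensity (rotation w z) = gaussDensity z := by
        exact NNReal.eq (by rw [coe_gaussDensity, coe_gaussDensity, LinearIsometryEquiv.norm_map])
      rw [this, rotation_apply, map_mul, mul_pow, mul_pow, mul_mul_mul_comm, hw, neg_one_mul,
        smul_neg]
    simp_rw [h2, integral_neg] at h1
    exact self_eq_neg.1 h1.symm

instance : IsProbabilityMeasure gaussC := by
  have h1 : Integrable (fun _ : ℂ => (1 : ℂ)) gaussC := by simpa using integrable_gaussC 0 0
  have h2 : ∫ _ : ℂ, (1 : ℂ) ∂gaussC = 1 := by simpa using integral_gaussC 0 0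
  have : IsFiniteMeasure gaussC := (integrable_const_iff_isFiniteMeasure one_ne_zero).1 h1
  refine ⟨?_⟩
  rw [integral_const] at h2
  have h3 : gaussC.real Set.univ = 1 := by simpa using h2
  rw [Measure.real, ENNReal.toReal_eq_one_iff] at h3
  exact h3

lemma measurePreserving_gaussC (φ : ℂ ≃ₗᵢ[ℝ] ℂ) : MeasurePreserving φ gaussC gaussC := by
  refine ⟨φ.continuous.measurable, ?_⟩
  ext s hs
  rw [Measure.map_apply φ.continuous.measurable hs, gaussC,
    withDensity_apply _ (φ.continuous.measurable hs), withDensity_apply _ hs,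
    ← φ.measurePreserving.setLIntegral_comp_preimage hs
      (measurable_gaussDensity.coe_nnreal_ennreal)]
  have : ∀ z, gaussDensity (φ z) = gaussDensity z := fun z => by
    exact NNReal.eq (by rw [coe_gaussDensity, coe_gaussDensity, LinearIsometryEquiv.norm_map])
  simp_rw [this]

lemma measurePreserving_conj : MeasurePreserving (fun z : ℂ => conj z) gaussC gaussC :=
  measurePreserving_gaussC Complex.conjLIE

lemma measurePreserving_neg_conj : MeasurePreserving (fun z : ℂ => -conj z) gaussC gaussC :=
  measurePreserving_gaussC (Complex.conjLIE.trans (LinearIsometryEquiv.neg ℝ))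

end GaussianMoments

section MultiplicationOperators

open MeasureTheory

lemma norm_mul_comp_le {Z X : Type*} [TopologicalSpace X] [CompactSpace X] {x : Z → X} (g : C(X, ℂ))
    (f : Z → ℂ) (z : Z) : ‖g (x z) * f z‖ ≤ ‖g‖ * ‖f z‖ := by
  rw [norm_mul]
  exact mul_le_mul_of_nonneg_right (g.norm_coe_le_norm _) (norm_nonneg _)

variable {Z X : Type*} [MeasurableSpace Z] {μ : Measure Z} [TopologicalSpace X] [CompactSpace X]
  [MeasurableSpace X] [BorelSpace X] {x : Z → X}

lemma MeasureTheory.MemLp.mul_comp (hx : Measurable x) (g : C(X, ℂ)) {f : Z → ℂ} (hf : MemLp f 2 μ) :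
    MemLp (fun z => g (x z) * f z) 2 μ :=
  hf.of_le_mul (c := ‖g‖)
    ((g.continuous.measurable.comp hx).aestronglyMeasurable.mul hf.aestronglyMeasurable)
    (Filter.Eventually.of_forall fun z => norm_mul_comp_le g f z)

/-- Multiplication of square integrable functions by `g ∘ x`. -/
def mulOpAux (hx : Measurable x) (g : C(X, ℂ)) : Lp ℂ 2 μ →L[ℂ] Lp ℂ 2 μ :=
  LinearMap.mkContinuous
    { toFun := fun f => ((Lp.memLp f).mul_comp hx g).toLp _
      map_add' := fun f f' => by
        rw [← MemLp.toLp_add]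
        refine MemLp.toLp_congr _ _ ?_
        filter_upwards [Lp.coeFn_add f f'] with z hz
        rw [hz, Pi.add_apply, Pi.add_apply, mul_add]
      map_smul' := fun s f => by
        rw [RingHom.id_apply, ← MemLp.toLp_const_smul]
        refine MemLp.toLp_congr _ _ ?_
        filter_upwards [Lp.coeFn_smul s f] with z hz
        simp [hz, mul_left_comm] }
    ‖g‖ fun f => by
      refine Lp.norm_le_mul_norm_of_ae_le_mul ?_
      filter_upwards [((Lp.memLp f).mul_comp hx g).coeFn_toLp] with z hz
      simp only [LinearMap.coe_mk, AddHom.coe_mk, hz]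
      exact norm_mul_comp_le g f z

lemma coeFn_mulOpAux (hx : Measurable x) (g : C(X, ℂ)) (f : Lp ℂ 2 μ) :
    mulOpAux hx g f =ᵐ[μ] fun z => g (x z) * f z :=
  ((Lp.memLp f).mul_comp hx g).coeFn_toLp

/-- Multiplication by `g ∘ x`, as a representation of the algebra of continuous functions. -/
def mulOp (hx : Measurable x) : C(X, ℂ) →ₐ[ℂ] (Lp ℂ 2 μ →L[ℂ] Lp ℂ 2 μ) where
  toFun := mulOpAux hx
  map_one' := by
    ext1 f; refine Lp.ext ?_
    filter_upwards [coeFn_mulOpAux hx 1 f] with z hz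
    simp [hz]
  map_zero' := by
    ext1 f; refine Lp.ext ?_
    filter_upwards [coeFn_mulOpAux hx 0 f, Lp.coeFn_zero ℂ 2 μ] with z hz h0
    rw [hz, ContinuousMap.zero_apply, zero_mul]; exact h0.symm
  map_add' g g' := by
    ext1 f; refine Lp.ext ?_
    rw [_root_.add_apply]
    filter_upwards [coeFn_mulOpAux hx (g + g') f, coeFn_mulOpAux hx g f, coeFn_mulOpAux hx g' f,
      Lp.coeFn_add (mulOpAux hx g f) (mulOpAux hx g' f)] with z h1 h2 h3 h4
    rw [h1, h4, Pi.add_apply, h2, h3, ContinuousMap.add_apply, add_mul]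
  map_mul' g g' := by
    ext1 f; refine Lp.ext ?_
    rw [mul_apply_eq_comp]
    filter_upwards [coeFn_mulOpAux hx (g * g') f, coeFn_mulOpAux hx g (mulOpAux hx g' f),
      coeFn_mulOpAux hx g' f] with z h1 h2 h3
    simp [h1, h2, h3, mul_assoc]
  commutes' s := by
    ext1 f; refine Lp.ext ?_
    rw [Algebra.algebraMap_eq_smul_one, Algebra.algebraMap_eq_smul_one, _root_.smul_apply]
    filter_upwards [coeFn_mulOpAux hx (s • 1) f, Lp.coeFn_smul s f] with z h1 h2
    simp [h1, h2]

lemma norm_mulOp_le (hx : Measurable x) (g : C(X, ℂ)) : ‖mulOp (μ := μ) hx g‖ ≤ ‖g‖ :=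
  by
  refine ContinuousLinearMap.opNorm_le_bound _ (norm_nonneg _) fun f => ?_
  refine Lp.norm_le_mul_norm_of_ae_le_mul ?_
  filter_upwards [coeFn_mulOpAux hx g f] with z hz
  exact (congrArg norm hz).le.trans (norm_mul_comp_le g f z)

lemma mulOp_toLp (hx : Measurable x) (g : C(X, ℂ)) {f : Z → ℂ} (hf : MemLp f 2 μ) :
    mulOp hx g (hf.toLp f) = (hf.mul_comp hx g).toLp _ := by
  refine Lp.ext ((coeFn_mulOpAux hx g _).trans ?_)
  filter_upwards [(hf.mul_comp hx g).coeFn_toLp, hf.coeFn_toLp] with z h1 h2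
  rw [h1, h2]

lemma inner_toLp {f f' : Z → ℂ} (hf : MemLp f 2 μ) (hf' : MemLp f' 2 μ) :
    inner ℂ (hf.toLp f) (hf'.toLp f') = ∫ z, conj (f z) * f' z ∂μ := by
  rw [L2.inner_def]
  refine integral_congr_ae ?_
  filter_upwards [hf.coeFn_toLp, hf'.coeFn_toLp] with z h1 h2
  rw [h1, h2, RCLike.inner_apply, mul_comm]

end MultiplicationOperators

section Monomials

open MeasureTheory

/-- The standard Gaussian measure on `ℂ⁴`. -/
def gauss4 : Measure (Fin 4 → ℂ) := Measure.pi fun _ => gaussC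

instance : IsProbabilityMeasure gauss4 := by unfold gauss4; infer_instance

/-- The function `∏ z_i ^ α_i (conj z_i) ^ β_i`. -/
def mono (α β : Fin 4 → ℕ) (z : Fin 4 → ℂ) : ℂ := ∏ i, (z i ^ α i * conj (z i) ^ β i)

lemma conj_mono (α β : Fin 4 → ℕ) (z : Fin 4 → ℂ) : conj (mono α β z) = mono β α z := by
  simp only [mono, map_prod, map_mul, map_pow, Complex.conj_conj]
  exact Finset.prod_congr rfl fun i _ => mul_comm _ _

lemma mono_mul (α β α' β' : Fin 4 → ℕ) (z : Fin 4 → ℂ) :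
    mono α β z * mono α' β' z = mono (α + α') (β + β') z := by
  simp only [mono, ← Finset.prod_mul_distrib, Pi.add_apply, pow_add]
  exact Finset.prod_congr rfl fun i _ => by ring

lemma integrable_mono (α β : Fin 4 → ℕ) : Integrable (mono α β) gauss4 :=
  Integrable.fintype_prod (f := fun i (z : ℂ) => z ^ α i * conj z ^ β i)
    fun _ => integrable_gaussC _ _

/-- The product of the factorials of a multi-index. -/
def fac (α : Fin 4 → ℕ) : ℝ := ∏ i, ((α i).factorial : ℝ)

lemma fac_pos (α : Fin 4 → ℕ) : 0 < fac α := Finset.prod_pos fun _ _ => by positivity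

lemma fac_add_single (α : Fin 4 → ℕ) (k : Fin 4) :
    fac (α + Pi.single k 1) = (α k + 1) * fac α := by
  fin_cases k <;> simp [fac, Fin.prod_univ_four, Nat.factorial_succ] <;> ring

lemma integral_mono (α β : Fin 4 → ℕ) :
    ∫ z, mono α β z ∂gauss4 = if α = β then (fac α : ℂ) else 0 := by
  have h := integral_fintype_prod_eq_prod (μ := fun _ : Fin 4 => gaussC)
    (f := fun i (z : ℂ) => z ^ α i * conj z ^ β i)
  simp only [integral_gaussC] at h
  refine h.trans ?_
  split_ifs with hαβ
  · simp [hαβ, fac]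
  · obtain ⟨_, hi⟩ := Function.ne_iff.1 hαβ
    exact Finset.prod_eq_zero (Finset.mem_univ _) (if_neg hi)

lemma continuous_mono (α β : Fin 4 → ℕ) : Continuous (mono α β) := by
  unfold mono; fun_prop

lemma memLp_mono (α β : Fin 4 → ℕ) : MemLp (mono α β) 2 gauss4 := by
  rw [memLp_two_iff_integrable_sq_norm (continuous_mono α β).aestronglyMeasurable]
  have := (integrable_mono (α + β) (β + α)).norm
  refine this.congr (Filter.Eventually.of_forall fun z => ?_)
  simp only [← mono_mul, norm_mul]
  rw [← conj_mono α β, RCLike.norm_conj, sq]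

/-- The function `mono α β` as an element of the Hilbert space. -/
def monoL (α β : Fin 4 → ℕ) : Lp ℂ 2 gauss4 := (memLp_mono α β).toLp _

lemma inner_monoL (α β α' β' : Fin 4 → ℕ) :
    inner ℂ (monoL α β) (monoL α' β') = if β + α' = α + β' then (fac (β + α') : ℂ) else 0 := by
  rw [monoL, monoL, inner_toLp]
  simp only [conj_mono, mono_mul, integral_mono]

lemma norm_monoL_sq (α : Fin 4 → ℕ) : ‖monoL α 0‖ ^ 2 = fac α := by
  have := inner_monoL α 0 α 0
  rw [inner_self_eq_norm_sq_to_K] at this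
  simp at this
  exact_mod_cast this

end Monomials

section ProjectiveSpace

open MeasureTheory

/-- Complex projective 3-space, as the space of rank one projections of `ℂ⁴`. -/
def CP3 : Set (Fin 4 → Fin 4 → ℂ) :=
  (fun z i j => z i * conj (z j)) '' {z : Fin 4 → ℂ | ∑ i, ‖z i‖ ^ 2 = 1}

instance : CompactSpace CP3 := by
  refine isCompact_iff_compactSpace.1 (IsCompact.image ?_ (by fun_prop))
  refine Metric.isCompact_of_isClosed_isBounded (isClosed_eq (by fun_prop) continuous_const) ?_
  refine (Metric.isBounded_closedBall (x := (0 : Fin 4 → ℂ)) (r := 1)).subset fun z hz => ?_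
  rw [mem_closedBall_zero_iff, pi_norm_le_iff_of_nonneg zero_le_one]
  intro i
  have h1 : ‖z i‖ ^ 2 ≤ ∑ i, ‖z i‖ ^ 2 :=
    Finset.single_le_sum (f := fun i => ‖z i‖ ^ 2) (fun _ _ => by positivity) (Finset.mem_univ i)
  rw [Set.mem_ofPred_eq] at hz
  rw [hz] at h1
  exact (sq_le_one_iff₀ (norm_nonneg _)).1 h1

lemma normalize_mem_CP3 {z : Fin 4 → ℂ} (hz : z ≠ 0) :
    (fun i j => z i * conj (z j) / ((∑ k, ‖z k‖ ^ 2 : ℝ) : ℂ)) ∈ CP3 := by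
  have hpos : 0 < ∑ k, ‖z k‖ ^ 2 := by
    obtain ⟨i, hi⟩ := Function.ne_iff.1 hz
    exact Finset.sum_pos' (fun _ _ => by positivity) ⟨i, Finset.mem_univ i, by
      have : 0 < ‖z i‖ := norm_pos_iff.2 hi
      positivity⟩
  set N := ∑ k, ‖z k‖ ^ 2
  refine ⟨fun i => z i / (Real.sqrt N : ℂ), ?_, ?_⟩
  · simp only [Set.mem_ofPred_eq, norm_div, Complex.norm_real, div_pow, Real.norm_eq_abs, sq_abs,
      Real.sq_sqrt hpos.le]
    rw [← Finset.sum_div, div_self hpos.ne']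
  · funext i j
    change z i / _ * conj (z j / _) = _
    rw [map_div₀, Complex.conj_ofReal, div_mul_div_comm, ← Complex.ofReal_mul,
      Real.mul_self_sqrt hpos.le]

instance : Inhabited CP3 :=
  ⟨⟨_, normalize_mem_CP3 (z := 1) one_ne_zero⟩⟩

open Classical in
/-- The projection of `ℂ⁴` to projective space (with an arbitrary value at the origin). -/
def toCP3 (z : Fin 4 → ℂ) : CP3 :=
  if hz : z = 0 then default else ⟨_, normalize_mem_CP3 hz⟩

lemma measurable_toCP3 : Measurable toCP3 := by
  classical
  have h : (fun z => (toCP3 z).1) = fun z => if z = 0 then (default : CP3).1 else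
      fun i j => z i * conj (z j) / ((∑ k, ‖z k‖ ^ 2 : ℝ) : ℂ) := by
    funext z
    by_cases hz : z = 0 <;> simp [toCP3, hz]
  refine Measurable.subtype_mk (f := fun z => (toCP3 z).1) ?_
  rw [h]
  refine Measurable.ite (measurableSet_singleton _) measurable_const ?_
  fun_prop

/-- The matrix entries, as functions on projective space. -/
def gen (i j : Fin 4) : C(CP3, ℂ) := 
  ⟨fun g => g.1 i j, (continuous_apply j).comp ((continuous_apply i).comp continuous_subtype_val)⟩

lemma star_gen (i j : Fin 4) : star (gen i j) = gen j i := by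
  ext ⟨g, z, hz, rfl⟩
  simp [gen, mul_comm]

lemma norm_gen_le (i j : Fin 4) : ‖gen i j‖ ≤ 1 := by
  refine (ContinuousMap.norm_le _ zero_le_one).2 ?_
  rintro ⟨g, z, hz, rfl⟩
  have h (i : Fin 4) : ‖z i‖ ≤ 1 := by
    have h1 : ‖z i‖ ^ 2 ≤ ∑ i, ‖z i‖ ^ 2 :=
      Finset.single_le_sum (f := fun i => ‖z i‖ ^ 2) (fun _ _ => by positivity) (Finset.mem_univ i)
    rw [Set.mem_ofPred_eq] at hz
    rw [hz] at h1
    exact (sq_le_one_iff₀ (norm_nonneg _)).1 h1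
  simpa [gen] using mul_le_one₀ (h i) (norm_nonneg _) (h j)

lemma gen_toCP3_mul (i j : Fin 4) (z : Fin 4 → ℂ) :
    gen i j (toCP3 z) * ∑ k, z k * conj (z k) = z i * conj (z j) := by
  by_cases hz : z = 0
  · simp [hz]
  · have hpos : 0 < ∑ k, ‖z k‖ ^ 2 := by
      obtain ⟨i, hi⟩ := Function.ne_iff.1 hz
      exact Finset.sum_pos' (fun _ _ => by positivity) ⟨i, Finset.mem_univ i, by
        have : 0 < ‖z i‖ := norm_pos_iff.2 hi
        positivity⟩
    have h1 : ∑ k, z k * conj (z k) = ((∑ k, ‖z k‖ ^ 2 : ℝ) : ℂ) := by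
      simp [Complex.mul_conj, Complex.normSq_eq_norm_sq]
    have h2 : ((∑ k, ‖z k‖ ^ 2 : ℝ) : ℂ) ≠ 0 := by exact_mod_cast hpos.ne'
    rw [h1, toCP3, dif_neg hz]
    simp only [gen, ContinuousMap.coe_mk]
    exact div_mul_cancel₀ _ h2

/-- Multiplication of square integrable functions on `ℂ⁴` by functions on projective space. -/
abbrev toeplitz : C(CP3, ℂ) →ₐ[ℂ] (Lp ℂ 2 gauss4 →L[ℂ] Lp ℂ 2 gauss4) := mulOp measurable_toCP3

/-- The multi-indices of degree `n`. -/
abbrev Ind (n : ℕ) : Type := {α : Fin 4 → ℕ // ∑ i, α i = n}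

instance (n : ℕ) : Fintype (Ind n) :=
  Fintype.subtype (Finset.piAntidiag Finset.univ n) (by simp)

/-- The monomials of degree `n`. -/
def monoFam (n : ℕ) (α : Ind n) : Lp ℂ 2 gauss4 := monoL α.1 0

lemma monoFam_orthogonal (n : ℕ) (α β : Ind n) (h : α ≠ β) :
    inner ℂ (monoFam n α) (monoFam n β) = 0 := by
  rw [monoFam, monoFam, inner_monoL, if_neg]
  intro h'
  exact h (Subtype.ext (by simpa using h'.symm))

lemma monoFam_ne_zero (n : ℕ) (α : Ind n) : monoFam n α ≠ 0 := by
  intro h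
  have := norm_monoL_sq α.1
  rw [show monoL α.1 0 = 0 from h] at this
  have h2 := fac_pos α.1
  simp at this
  linarith

/-- The matrix of `z_i ∂_j` on polynomials of degree `n`. -/
def shiftMatrix (n : ℕ) (i j : Fin 4) : Matrix (Ind n) (Ind n) ℂ :=
  Matrix.of fun β α => if β.1 + Pi.single j 1 = α.1 + Pi.single i 1 then (α.1 j : ℂ) else 0

lemma norm_synth_sq {𝓗 : Type*} [NormedAddCommGroup 𝓗] [InnerProductSpace ℂ 𝓗] {ι : Type*}
    [Fintype ι] {e : ι → 𝓗} (horth : ∀ a b, a ≠ b → inner ℂ (e a) (e b) = 0) (c : ι → ℂ) :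
    ‖synth e c‖ ^ 2 = ∑ a, ‖c a‖ ^ 2 * ‖e a‖ ^ 2 := by
  have h : inner ℂ (synth e c) (synth e c) = ((∑ a, ‖c a‖ ^ 2 * ‖e a‖ ^ 2 : ℝ) : ℂ) := by
    conv_lhs => enter [2]; rw [synth]
    rw [sum_inner]
    push_cast
    refine Finset.sum_congr rfl fun a _ => ?_
    rw [inner_smul_left, inner_synth horth, ← mul_assoc, mul_comm (conj (c a)), Complex.mul_conj,
      Complex.normSq_eq_norm_sq]
    push_cast; ring
  rw [inner_self_eq_norm_sq_to_K] at h
  refine Complex.ofReal_injective ?_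
  rw [← h]
  simp

lemma norm_synth_le {𝓗 : Type*} [NormedAddCommGroup 𝓗] [InnerProductSpace ℂ 𝓗] {ι : Type*}
    [Fintype ι] {e f : ι → 𝓗} (he : ∀ a b, a ≠ b → inner ℂ (e a) (e b) = 0)
    (hf : ∀ a b, a ≠ b → inner ℂ (f a) (f b) = 0) {K : ℝ} (hK : 0 ≤ K)
    (h : ∀ a, ‖f a‖ ^ 2 ≤ K * ‖e a‖ ^ 2) (c : ι → ℂ) :
    ‖synth f c‖ ≤ Real.sqrt K * ‖synth e c‖ := by
  refine le_of_sq_le_sq ?_ (by positivity)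
  rw [mul_pow, Real.sq_sqrt hK, norm_synth_sq he, norm_synth_sq hf, Finset.mul_sum]
  refine Finset.sum_le_sum fun a _ => ?_
  nlinarith [h a, sq_nonneg ‖c a‖]

/-- The component of `(n + 4) e_α` orthogonal to the multiples of `∑ z_k conj z_k`. -/
def radialDefect (n : ℕ) (α : Ind n) : Lp ℂ 2 gauss4 :=
  ((n : ℂ) + 4) • monoL α.1 0 - ∑ k, monoL (α.1 + Pi.single k 1) (Pi.single k 1)

/-- The difference between `z_i conj z_j e_α` and `z_i ∂_j e_α`. -/
def shiftDefect (i j : Fin 4) (n : ℕ) (α : Ind n) : Lp ℂ 2 gauss4 :=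
  monoL (α.1 + Pi.single i 1) (Pi.single j 1) -
    (α.1 j : ℂ) • monoL (α.1 - Pi.single j 1 + Pi.single i 1) 0

end ProjectiveSpace

section Estimates

open MeasureTheory

lemma inner_monoL_of_eq {α β α' β' : Fin 4 → ℕ} (h : β + α' = α + β') :
    inner ℂ (monoL α β) (monoL α' β') = (fac (β + α') : ℂ) := by rw [inner_monoL, if_pos h]

lemma inner_monoL_of_ne {α β α' β' : Fin 4 → ℕ} (h : β + α' ≠ α + β') :
    inner ℂ (monoL α β) (monoL α' β') = 0 := by rw [inner_monoL, if_neg h]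

lemma sum_cast_ind {n : ℕ} (α : Ind n) :
    (α.1 0 : ℝ) + α.1 1 + α.1 2 + α.1 3 = n := by
  have := α.2
  rw [Fin.sum_univ_four] at this
  exact_mod_cast this

lemma radialDefect_orthogonal (n : ℕ) (α β : Ind n) (h : α ≠ β) :
    inner ℂ (radialDefect n α) (radialDefect n β) = 0 := by
  have hne : ∀ γ γ' δ δ' : Fin 4 → ℕ, γ + β.1 + δ = α.1 + δ' → δ' = γ + δ → False := by
    intro γ γ' δ δ' h1 h2
    apply h
    ext i
    have := congrFun h1 i
    rw [h2] at this
    simp only [Pi.add_apply] at this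
    omega
  have h0 : inner ℂ (monoL α.1 0) (monoL β.1 0) = 0 := inner_monoL_of_ne fun h1 =>
    hne 0 0 0 0 (by rw [add_zero, h1]) (by rw [add_zero])
  have h1 : ∀ k : Fin 4, inner ℂ (monoL α.1 0) (monoL (β.1 + Pi.single k 1) (Pi.single k 1)) = 0 :=
    fun k => inner_monoL_of_ne fun h1 => hne 0 0 (Pi.single k 1) (Pi.single k 1)
      (by rw [← h1, add_assoc]) (by rw [zero_add])
  have h2 : ∀ k : Fin 4, inner ℂ (monoL (α.1 + Pi.single k 1) (Pi.single k 1)) (monoL β.1 0) = 0 :=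
    fun k => inner_monoL_of_ne fun h1 => hne (Pi.single k 1) 0 0 (Pi.single k 1)
      (by rw [add_zero, h1, add_zero]) (by rw [add_zero])
  have h3 : ∀ k l : Fin 4, inner ℂ (monoL (α.1 + Pi.single k 1) (Pi.single k 1))
      (monoL (β.1 + Pi.single l 1) (Pi.single l 1)) = 0 :=
    fun k l => inner_monoL_of_ne fun h1 =>
      hne (Pi.single k 1) 0 (Pi.single l 1) (Pi.single k 1 + Pi.single l 1)
        (by rw [add_assoc, h1, add_assoc]) rfl
  simp only [radialDefect, inner_sub_left, inner_sub_right, inner_smul_left, inner_smul_right,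
    inner_sum, sum_inner, h0, h1, h2, h3]
  simp

lemma norm_radialDefect_sq (n : ℕ) (α : Ind n) :
    ‖radialDefect n α‖ ^ 2 = (n + 4) * fac α.1 := by
  have key : inner ℂ (radialDefect n α) (radialDefect n α) = (((n + 4) * fac α.1 : ℝ) : ℂ) := by
    simp only [radialDefect, inner_sub_left, inner_sub_right, inner_smul_left, inner_smul_right,
      inner_sum, sum_inner]
    rw [inner_monoL_of_eq (by simp)]
    have h1 : ∀ k : Fin 4, inner ℂ (monoL α.1 0) (monoL (α.1 + Pi.single k 1) (Pi.single k 1)) =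
        (((α.1 k + 1) * fac α.1 : ℝ) : ℂ) := fun k => by
      rw [inner_monoL_of_eq (by simp), zero_add, fac_add_single]
    have h2 : ∀ k : Fin 4, inner ℂ (monoL (α.1 + Pi.single k 1) (Pi.single k 1)) (monoL α.1 0) =
        (((α.1 k + 1) * fac α.1 : ℝ) : ℂ) := fun k => by
      rw [inner_monoL_of_eq (by simp [add_comm]), add_comm, fac_add_single]
    have h3 : ∀ k l : Fin 4, inner ℂ (monoL (α.1 + Pi.single k 1) (Pi.single k 1))
        (monoL (α.1 + Pi.single l 1) (Pi.single l 1)) =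
        ((((α.1 + Pi.single l 1 : Fin 4 → ℕ) k + 1 : ℕ) * ((α.1 l + 1) * fac α.1) : ℝ) : ℂ) := fun k l => by
      rw [inner_monoL_of_eq (by abel), add_comm, fac_add_single, fac_add_single]
      push_cast; ring
    simp only [h1, h2, h3, Fin.sum_univ_four]
    simp only [zero_add, map_add, map_natCast, Complex.conj_ofNat]
    norm_cast
    have hs := sum_cast_ind α
    push_cast
    simp
    rw [← hs]
    ring
  rw [inner_self_eq_norm_sq_to_K] at key
  refine Complex.ofReal_injective ?_
  rw [← key]
  simp

lemma shiftDefect_orthogonal (i j : Fin 4) (n : ℕ) (α β : Ind n) (h : α ≠ β) :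
    inner ℂ (shiftDefect i j n α) (shiftDefect i j n β) = 0 := by
  obtain ⟨m, hm⟩ := Function.ne_iff.1 (Subtype.coe_ne_coe.2 h)
  simp only [shiftDefect, inner_sub_left, inner_sub_right, inner_smul_left, inner_smul_right]
  have hz : ∀ γ δ : Fin 4 → ℕ, γ = δ → γ m = δ m := fun _ _ h => congrFun h m
  rw [inner_monoL_of_ne (fun h1 => ?_)]
  swap
  · have := hz _ _ h1
    simp only [Pi.add_apply] at this
    omega
  have h1 : (β.1 j : ℂ) * inner ℂ (monoL (α.1 + Pi.single i 1) (Pi.single j 1))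
      (monoL (β.1 - Pi.single j 1 + Pi.single i 1) 0) = 0 := by
    by_cases hb : β.1 j = 0
    · simp [hb]
    · rw [inner_monoL_of_ne, mul_zero]
      intro h1
      have := hz _ _ h1
      simp only [Pi.add_apply, Pi.sub_apply, Pi.zero_apply, Pi.single_apply] at this
      by_cases hmj : m = j
      · subst hmj; simp at this; omega
      · simp [hmj] at this; omega
  have h2 : conj (α.1 j : ℂ) * inner ℂ (monoL (α.1 - Pi.single j 1 + Pi.single i 1) 0)
      (monoL (β.1 + Pi.single i 1) (Pi.single j 1)) = 0 := by
    by_cases hb : α.1 j = 0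
    · simp [hb]
    · rw [inner_monoL_of_ne, mul_zero]
      intro h1
      have := hz _ _ h1
      simp only [Pi.add_apply, Pi.sub_apply, Pi.zero_apply, Pi.single_apply] at this
      by_cases hmj : m = j
      · subst hmj; simp at this; omega
      · simp [hmj] at this; omega
  have h3 : (β.1 j : ℂ) * (conj (α.1 j : ℂ) * inner ℂ (monoL (α.1 - Pi.single j 1 + Pi.single i 1) 0)
      (monoL (β.1 - Pi.single j 1 + Pi.single i 1) 0)) = 0 := by
    by_cases hb : β.1 j = 0
    · simp [hb]
    by_cases ha : α.1 j = 0
    · simp [ha]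
    rw [inner_monoL_of_ne, mul_zero, mul_zero]
    intro h1
    have := hz _ _ h1
    simp only [Pi.add_apply, Pi.sub_apply, Pi.zero_apply, Pi.single_apply] at this
    by_cases hmj : m = j
    · subst hmj; simp at this; omega
    · simp [hmj] at this; omega
  rw [mul_sub, h1, h2, h3]; simp

lemma norm_shiftDefect_sq (i j : Fin 4) (n : ℕ) (α : Ind n) :
    ‖shiftDefect i j n α‖ ^ 2 = (α.1 i + 1 + if i = j then 1 else 0) * fac α.1 := by
  have key : inner ℂ (shiftDefect i j n α) (shiftDefect i j n α) =
      (((α.1 i + 1 + if i = j then 1 else 0) * fac α.1 : ℝ) : ℂ) := by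
    have h0 : inner ℂ (monoL (α.1 + Pi.single i 1) (Pi.single j 1))
        (monoL (α.1 + Pi.single i 1) (Pi.single j 1)) =
        ((((α.1 + Pi.single j 1 : Fin 4 → ℕ) i + 1 : ℕ) * ((α.1 j + 1) * fac α.1) : ℝ) : ℂ) := by
      rw [inner_monoL_of_eq (by abel), show Pi.single j 1 + (α.1 + Pi.single i 1) =
        α.1 + Pi.single j 1 + Pi.single i 1 by abel, fac_add_single, fac_add_single]
      push_cast; ring
    simp only [shiftDefect, inner_sub_left, inner_sub_right, inner_smul_left, inner_smul_right]
    rw [h0]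
    by_cases ha : α.1 j = 0
    · by_cases hij : i = j <;> simp [ha, hij]
      left; ring
    · obtain ⟨γ, hγ⟩ : ∃ γ : Fin 4 → ℕ, α.1 = γ + Pi.single j 1 := by
        refine ⟨α.1 - Pi.single j 1, ?_⟩
        ext m
        by_cases hmj : m = j
        · subst hmj; simp; omega
        · simp [hmj]
      rw [hγ, add_tsub_cancel_right, inner_monoL_of_eq (by abel), inner_monoL_of_eq (by abel),
        inner_monoL_of_eq (by abel)]
      have e1 : Pi.single j 1 + (γ + Pi.single i 1) = γ + Pi.single j 1 + Pi.single i 1 := by abel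
      have h3 : (fac (γ + Pi.single j 1) : ℂ) = (γ j + 1) * fac γ := by
        rw [fac_add_single]; push_cast; ring
      have h4 : (fac (γ + Pi.single i 1) : ℂ) = (γ i + 1) * fac γ := by
        rw [fac_add_single]; push_cast; ring
      have h5 : (fac (γ + Pi.single j 1 + Pi.single i 1) : ℂ) =
          ((γ + Pi.single j 1 : Fin 4 → ℕ) i + 1) * ((γ j + 1) * fac γ) := by
        rw [fac_add_single, Complex.ofReal_mul, h3]; push_cast; ring
      simp only [zero_add, e1, h4, h5, Complex.ofReal_mul, Complex.ofReal_add, h3]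
      simp only [map_natCast]
      by_cases hij : i = j
      · subst hij; simp; ring
      · simp [hij]; ring
  rw [inner_self_eq_norm_sq_to_K] at key
  refine Complex.ofReal_injective ?_
  rw [← key]
  simp

end Estimates

section Quantization

open MeasureTheory

lemma toeplitz_gen_sum (i j : Fin 4) (α : Fin 4 → ℕ) :
    toeplitz (gen i j) (∑ k, monoL (α + Pi.single k 1) (Pi.single k 1)) =
      monoL (α + Pi.single i 1) (Pi.single j 1) := by
  have h (k l : Fin 4) (z : Fin 4 → ℂ) :
      mono (α + Pi.single k 1) (Pi.single l 1) z = z k * conj (z l) * mono α 0 z := by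
    have e1 : ∏ m, z m ^ (Pi.single k 1 : Fin 4 → ℕ) m = z k := by
      rw [Finset.prod_eq_single k] <;> simp +contextual
    have e2 : ∏ m, conj (z m) ^ (Pi.single l 1 : Fin 4 → ℕ) m = conj (z l) := by
      rw [Finset.prod_eq_single l] <;> simp +contextual
    simp only [mono, Pi.add_apply, pow_add, Finset.prod_mul_distrib, e1, e2]
    simp
    ring
  rw [map_sum]
  simp only [monoL, mulOp_toLp]
  rw [Fin.sum_univ_four, ← MemLp.toLp_add, ← MemLp.toLp_add, ← MemLp.toLp_add]
  refine MemLp.toLp_congr _ _ (Filter.Eventually.of_forall fun z => ?_)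
  simp only [Pi.add_apply, h]
  rw [← gen_toCP3_mul i j z, Fin.sum_univ_four]
  ring

lemma synth_shiftMatrix_col (n : ℕ) (i j : Fin 4) (α : Ind n) :
    ∑ β, shiftMatrix n i j β α • monoFam n β =
      (α.1 j : ℂ) • monoL (α.1 - Pi.single j 1 + Pi.single i 1) 0 := by
  by_cases ha : α.1 j = 0
  · rw [ha]
    simp [shiftMatrix, ha]
  · have hle : (Pi.single j 1 : Fin 4 → ℕ) ≤ α.1 := by
      intro m
      by_cases hmj : m = j
      · subst hmj; simp; omega
      · simp [hmj]
    have hmem : ∑ m, (α.1 - Pi.single j 1 + Pi.single i 1 : Fin 4 → ℕ) m = n := by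
      have h1 : ∑ m, ((α.1 - Pi.single j 1) + Pi.single j 1 : Fin 4 → ℕ) m = n := by
        rw [tsub_add_cancel_of_le hle]; exact α.2
      simp only [Pi.add_apply, Finset.sum_add_distrib, Finset.sum_pi_single'] at h1 ⊢
      simpa using h1
    rw [Finset.sum_eq_single ⟨_, hmem⟩]
    · have : α.1 - Pi.single j 1 + Pi.single i 1 + Pi.single j 1 = α.1 + Pi.single i 1 := by
        rw [add_right_comm, tsub_add_cancel_of_le hle]
      simp [shiftMatrix, monoFam, this]
    · intro β _ hβ
      rw [shiftMatrix, Matrix.of_apply, if_neg, zero_smul]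
      intro h
      refine hβ (Subtype.ext ?_)
      rw [← tsub_add_cancel_of_le hle, add_right_comm] at h
      exact add_right_cancel h
    · simp

lemma toeplitz_gen_synth (n : ℕ) (i j : Fin 4) (c : Ind n → ℂ) :
    ((n : ℂ) + 4) • toeplitz (gen i j) (synth (monoFam n) c) -
      synth (monoFam n) ((shiftMatrix n i j).mulVec c) =
    toeplitz (gen i j) (synth (radialDefect n) c) + synth (shiftDefect i j n) c := by
  have h (α : Ind n) : ((n : ℂ) + 4) • toeplitz (gen i j) (monoFam n α) =
      toeplitz (gen i j) (radialDefect n α) + shiftDefect i j n α +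
        ∑ β, shiftMatrix n i j β α • monoFam n β := by
    rw [radialDefect, map_sub, toeplitz_gen_sum, map_smul, shiftDefect, synth_shiftMatrix_col,
      monoFam]
    abel
  have h2 : synth (monoFam n) ((shiftMatrix n i j).mulVec c) =
      ∑ α, c α • ∑ β, shiftMatrix n i j β α • monoFam n β := by
    simp only [synth, Matrix.mulVec, dotProduct, Finset.sum_smul, Finset.smul_sum, smul_smul]
    rw [Finset.sum_comm]
    exact Finset.sum_congr rfl fun α _ => Finset.sum_congr rfl fun β _ => by rw [mul_comm]
  rw [h2, synth, map_sum, Finset.smul_sum, synth, synth, map_sum, sub_eq_iff_eq_add,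
    ← Finset.sum_add_distrib, ← Finset.sum_add_distrib]
  refine Finset.sum_congr rfl fun α _ => ?_
  rw [map_smul, smul_comm, h, map_smul, smul_add, smul_add]

lemma norm_toeplitz_gen_le (i j : Fin 4) : ‖toeplitz (gen i j)‖ ≤ 1 :=
  (norm_mulOp_le measurable_toCP3 _).trans (norm_gen_le i j)

lemma approx_gen (n : ℕ) (i j : Fin 4) :
    Approx (monoFam n) (2 * (Real.sqrt (n + 4))⁻¹) (toeplitz (gen i j))
      (((n : ℂ) + 4)⁻¹ • shiftMatrix n i j) := fun c => by
  have hn : ((n : ℂ) + 4) ≠ 0 := by exact_mod_cast (by omega : n + 4 ≠ 0)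
  have hnorm : ‖((n : ℂ) + 4)⁻¹‖ = ((n : ℝ) + 4)⁻¹ := by
    rw [norm_inv, show ((n : ℂ) + 4) = ((n + 4 : ℕ) : ℂ) by push_cast; ring, Complex.norm_natCast]
    push_cast; ring
  have h1 : toeplitz (gen i j) (synth (monoFam n) c) -
      synth (monoFam n) ((((n : ℂ) + 4)⁻¹ • shiftMatrix n i j).mulVec c) = ((n : ℂ) + 4)⁻¹ •
        (toeplitz (gen i j) (synth (radialDefect n) c) + synth (shiftDefect i j n) c) := by
    rw [← toeplitz_gen_synth, smul_sub, smul_smul, inv_mul_cancel₀ hn, one_smul,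
      Matrix.smul_mulVec, synth_smul]
  have h2 : ‖synth (radialDefect n) c‖ ≤ Real.sqrt (n + 4) * ‖synth (monoFam n) c‖ :=
    norm_synth_le (monoFam_orthogonal n) (radialDefect_orthogonal n) (by positivity)
      (fun α => by rw [norm_radialDefect_sq, monoFam, norm_monoL_sq]) c
  have h3 : ‖synth (shiftDefect i j n) c‖ ≤ Real.sqrt (n + 4) * ‖synth (monoFam n) c‖ := by
    refine norm_synth_le (monoFam_orthogonal n) (shiftDefect_orthogonal i j n) (by positivity)
      (fun α => ?_) c
    rw [norm_shiftDefect_sq, monoFam, norm_monoL_sq]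
    refine mul_le_mul_of_nonneg_right ?_ (fac_pos _).le
    have h4 : (α.1 i : ℝ) ≤ n := by
      have := Finset.single_le_sum (f := α.1) (fun _ _ => Nat.zero_le _) (Finset.mem_univ i)
      rw [α.2] at this
      exact_mod_cast this
    split_ifs <;> linarith
  have h5 := (toeplitz (gen i j)).le_of_opNorm_le (norm_toeplitz_gen_le i j)
    (synth (radialDefect n) c)
  rw [h1, norm_smul, hnorm]
  have h6 : ((n : ℝ) + 4)⁻¹ * Real.sqrt (n + 4) = (Real.sqrt (n + 4))⁻¹ := by
    have hp : (0 : ℝ) < n + 4 := by positivity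
    have hq := Real.sqrt_pos.2 hp
    field_simp
    rw [Real.sq_sqrt hp.le]
  calc _ ≤ ((n : ℝ) + 4)⁻¹ * (2 * (Real.sqrt (n + 4) * ‖synth (monoFam n) c‖)) := by
        refine mul_le_mul_of_nonneg_left ((norm_add_le _ _).trans ?_) (by positivity)
        linarith
    _ = _ := by rw [← h6]; ring

lemma tendsto_two_mul_inv_sqrt :
    Filter.Tendsto (fun n : ℕ => 2 * (Real.sqrt (n + 4))⁻¹) Filter.atTop (nhds 0) := by
  rw [← mul_zero (2 : ℝ)]
  refine Filter.Tendsto.const_mul (2 : ℝ) (Filter.Tendsto.inv_tendsto_atTop ?_)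
  exact Real.tendsto_sqrt_atTop.comp
    (Filter.tendsto_atTop_add_const_right _ _ tendsto_natCast_atTop_atTop)

lemma quantizes_gen (i j : Fin 4) :
    Quantizes toeplitz monoFam (gen i j) (fun n => ((n : ℂ) + 4)⁻¹ • shiftMatrix n i j) :=
  fun ε hε => by
    filter_upwards [tendsto_two_mul_inv_sqrt.eventually (gt_mem_nhds hε)] with n hn
    exact (approx_gen n i j).mono hn.le

lemma quantizes_compress_toeplitz (g : C(CP3, ℂ)) :
    Quantizes toeplitz monoFam g (fun n => compress (monoFam n) (toeplitz g)) := by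
  refine quantizes_compress (fun g => norm_mulOp_le measurable_toCP3 g) monoFam_orthogonal
    monoFam_ne_zero (S := Set.range fun p : Fin 4 × Fin 4 => gen p.1 p.2) ?_ ?_ ?_ g
  · rintro _ ⟨p, rfl⟩
    exact ⟨_, quantizes_gen p.1 p.2⟩
  · rintro _ ⟨p, rfl⟩
    exact ⟨(p.2, p.1), (star_gen p.1 p.2).symm⟩
  · intro x y hxy
    by_contra! h
    refine hxy (Subtype.ext ?_)
    funext i j
    exact h _ ⟨(i, j), rfl⟩

end Quantization

section QuaternionicStructure

open MeasureTheory

/-- The permutation of coordinates underlying the quaternionic structure of `ℂ⁴`. -/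
def pairSwap : Equiv.Perm (Fin 4) := Equiv.swap 0 1 * Equiv.swap 2 3

lemma pairSwap_apply : (pairSwap 0 = 1 ∧ pairSwap 1 = 0) ∧ pairSwap 2 = 3 ∧ pairSwap 3 = 2 := by
  decide

/-- The quaternionic structure of `ℂ⁴`. -/
def quatJ (z : Fin 4 → ℂ) : Fin 4 → ℂ := ![-conj (z 1), conj (z 0), -conj (z 3), conj (z 2)]

lemma measurePreserving_quatJ : MeasurePreserving quatJ gauss4 gauss4 := by
  have h1 : MeasurePreserving (fun (z : Fin 4 → ℂ) i =>
      (![fun w => conj w, fun w => -conj w, fun w => conj w, fun w => -conj w] :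
        Fin 4 → ℂ → ℂ) i (z i)) gauss4 gauss4 := by
    refine measurePreserving_pi (fun _ => gaussC) (fun _ => gaussC) fun i => ?_
    fin_cases i
    exacts [measurePreserving_conj, measurePreserving_neg_conj, measurePreserving_conj,
      measurePreserving_neg_conj]
  have h2 := measurePreserving_piCongrLeft (fun _ : Fin 4 => gaussC) pairSwap
  have h3 : quatJ = MeasurableEquiv.piCongrLeft (fun _ : Fin 4 => ℂ) pairSwap ∘
      fun (z : Fin 4 → ℂ) i => (![fun w => conj w, fun w => -conj w, fun w => conj w,
        fun w => -conj w] : Fin 4 → ℂ → ℂ) i (z i) := by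
    funext z i
    obtain ⟨m, rfl⟩ := pairSwap.surjective i
    rw [Function.comp_apply, MeasurableEquiv.coe_piCongrLeft, Equiv.piCongrLeft_apply_apply]
    fin_cases m <;> simp [pairSwap_apply, quatJ]
  rw [h3]
  exact h2.comp h1

lemma quatJ_injective : Function.Injective quatJ := by
  intro z w h
  have h' (i : Fin 4) := congrFun h i
  have hc := (starRingEnd ℂ).injective
  funext i
  fin_cases i
  · exact hc (by simpa [quatJ] using h' 1)
  · exact hc (by simpa [quatJ] using h' 0)
  · exact hc (by simpa [quatJ] using h' 3)
  · exact hc (by simpa [quatJ] using h' 2)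

lemma continuous_quatJ : Continuous quatJ := by unfold quatJ; fun_prop

/-- The action of the quaternionic structure on multi-indices. -/
def indSwap (n : ℕ) : Equiv.Perm (Ind n) where
  toFun α := ⟨α.1 ∘ pairSwap, (Equiv.sum_comp pairSwap α.1).trans α.2⟩
  invFun α := ⟨α.1 ∘ pairSwap, (Equiv.sum_comp pairSwap α.1).trans α.2⟩
  left_inv α := Subtype.ext (funext fun i => congrArg α.1 (by fin_cases i <;> decide))
  right_inv α := Subtype.ext (funext fun i => congrArg α.1 (by fin_cases i <;> decide))

lemma indSwap_indSwap {n : ℕ} (α : Ind n) : indSwap n (indSwap n α) = α :=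
  (indSwap n).left_inv α

/-- The sign attached to a multi-index by the quaternionic structure. -/
def indSign (α : Fin 4 → ℕ) : ℂ := (-1) ^ (α 1 + α 3)

lemma indSign_mul_self (α : Fin 4 → ℕ) : indSign α * indSign α = 1 := by
  rw [indSign, ← pow_add, ← two_mul, pow_mul]; simp

lemma conj_indSign (α : Fin 4 → ℕ) : conj (indSign α) = indSign α := by simp [indSign]

lemma indSign_indSwap {n : ℕ} (α : Ind n) :
    indSign (indSwap n α).1 = (-1) ^ n * indSign α.1 := by
  have h : (-1 : ℂ) ^ n = (-1) ^ (α.1 0 + α.1 2) * indSign α.1 := by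
    rw [indSign, ← pow_add]
    congr 1
    have := α.2
    rw [Fin.sum_univ_four] at this
    omega
  rw [h, mul_assoc, indSign_mul_self, mul_one]
  rfl

/-- Conjugation of a matrix by the quaternionic structure. -/
def matJ {n : ℕ} (B : Matrix (Ind n) (Ind n) ℂ) : Matrix (Ind n) (Ind n) ℂ :=
  Matrix.of fun a b => indSign a.1 * indSign b.1 * conj (B (indSwap n a) (indSwap n b))

lemma matJ_matJ {n : ℕ} (B : Matrix (Ind n) (Ind n) ℂ) : matJ (matJ B) = B := by
  ext a b
  simp only [matJ, Matrix.of_apply, indSwap_indSwap, indSign_indSwap, map_mul, conj_indSign,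
    Complex.conj_conj, map_pow, map_neg, map_one]
  have h1 := indSign_mul_self a.1
  have h2 := indSign_mul_self b.1
  have h3 : ((-1 : ℂ) ^ n) * (-1) ^ n = 1 := by rw [← mul_pow]; simp
  linear_combination (indSign a.1 * indSign a.1 * (indSign b.1 * indSign b.1) * B a b) * h3 +
    B a b * (indSign b.1 * indSign b.1) * h1 + B a b * h2

lemma matJ_add {n : ℕ} (B C : Matrix (Ind n) (Ind n) ℂ) : matJ (B + C) = matJ B + matJ C := by
  ext a b; simp [matJ, mul_add]

lemma matJ_neg {n : ℕ} (B : Matrix (Ind n) (Ind n) ℂ) : matJ (-B) = -matJ B := by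
  ext a b; simp [matJ]

lemma matJ_sub {n : ℕ} (B C : Matrix (Ind n) (Ind n) ℂ) : matJ (B - C) = matJ B - matJ C := by
  rw [sub_eq_add_neg, matJ_add, matJ_neg, ← sub_eq_add_neg]

lemma matJ_smul {n : ℕ} (s : ℂ) (B : Matrix (Ind n) (Ind n) ℂ) :
    matJ (s • B) = conj s • matJ B := by
  ext a b; simp [matJ, mul_left_comm]

lemma matJ_mul {n : ℕ} (B C : Matrix (Ind n) (Ind n) ℂ) : matJ (B * C) = matJ B * matJ C := by
  ext a b
  simp only [matJ, Matrix.of_apply, Matrix.mul_apply, map_sum, map_mul, Finset.mul_sum]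
  rw [← Equiv.sum_comp (indSwap n)]
  refine Finset.sum_congr rfl fun c _ => ?_
  have := indSign_mul_self c.1
  linear_combination (-indSign a.1 * conj (B (indSwap n a) (indSwap n c)) * indSign b.1 *
    conj (C (indSwap n c) (indSwap n b))) * this

lemma matJ_shiftMatrix (n : ℕ) (i j : Fin 4) : matJ (shiftMatrix n i j) =
    ((![1, -1, 1, -1] i * ![1, -1, 1, -1] j : ℂ)) • shiftMatrix n (pairSwap i) (pairSwap j) := by
  ext β α
  have hsw (γ : Ind n) (k : Fin 4) : (indSwap n γ).1 k = γ.1 (pairSwap k) := rfl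
  have hp : (indSwap n β).1 + Pi.single j 1 = (indSwap n α).1 + Pi.single i 1 ↔
      β.1 + Pi.single (pairSwap j) 1 = α.1 + Pi.single (pairSwap i) 1 := by
    constructor <;> intro h <;> ext k
    · have := congrFun h (pairSwap k)
      fin_cases i <;> fin_cases j <;> fin_cases k <;> simpa [hsw, pairSwap_apply] using this
    · have := congrFun h (pairSwap k)
      fin_cases i <;> fin_cases j <;> fin_cases k <;> simpa [hsw, pairSwap_apply] using this
  simp only [matJ, shiftMatrix, Matrix.of_apply, Matrix.smul_apply, hp, smul_eq_mul]
  by_cases h : β.1 + Pi.single (pairSwap j) 1 = α.1 + Pi.single (pairSwap i) 1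
  · rw [if_pos h, if_pos h, hsw, Complex.conj_natCast]
    congr 1
    have h1 : indSign (β.1 + Pi.single (pairSwap j) 1) =
        indSign (α.1 + Pi.single (pairSwap i) 1) := by rw [h]
    have h3 (γ : Fin 4 → ℕ) (k : Fin 4) : indSign (γ + Pi.single (pairSwap k) 1) =
        -(![1, -1, 1, -1] k : ℂ) * indSign γ := by
      fin_cases k <;> simp [pairSwap_apply, indSign] <;> ring
    have h4 (k : Fin 4) : (![1, -1, 1, -1] k : ℂ) * ![1, -1, 1, -1] k = 1 := by
      fin_cases k <;> simp
    rw [h3, h3] at h1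
    have h5 := indSign_mul_self α.1
    linear_combination (-(![1, -1, 1, -1] j : ℂ) * indSign α.1) * h1 +
      (-(indSign α.1) * indSign β.1) * h4 j + (![1, -1, 1, -1] i * ![1, -1, 1, -1] j : ℂ) * h5
  · rw [if_neg h, if_neg h]; simp

/-- A block matrix which commutes with the quaternionic structure of `ℂ² ⊗ ℂ[z]`. -/
def QuatBlock {n : ℕ} (B : Fin 2 → Fin 2 → Matrix (Ind n) (Ind n) ℂ) : Prop :=
  B 1 1 = matJ (B 0 0) ∧ B 0 1 = -matJ (B 1 0)

lemma Matrix.det_eq_conj_of_symm {ι ι' : Type*} [Fintype ι] [DecidableEq ι] [Fintype ι']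
    [DecidableEq ι'] {M : Matrix ι ι ℂ} {N : Matrix ι' ι' ℂ} (e : ι ≃ ι') {s : ι → ℂ}
    (hs : ∀ a, s a * s a = 1) (h : ∀ a b, M a b = s a * s b * conj (N (e a) (e b))) :
    M.det = conj N.det := by
  have h1 : M = Matrix.diagonal s * ((N.submatrix e e).map (starRingEnd ℂ)) * Matrix.diagonal s := by
    ext a b
    rw [Matrix.mul_diagonal, Matrix.diagonal_mul, h a b]
    simp; ring
  rw [h1, Matrix.det_mul, Matrix.det_mul, Matrix.det_diagonal, mul_right_comm,
    ← Finset.prod_mul_distrib, Finset.prod_congr rfl fun a _ => hs a, Finset.prod_const_one,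
    one_mul, ← RingHom.mapMatrix_apply, ← RingHom.map_det, Matrix.det_submatrix_equiv_self]

/-- The action of the quaternionic structure on the basis of `ℂ² ⊗ ℂ[z]`. -/
def blockSwap (n : ℕ) : Equiv.Perm (Fin 2 × Ind n) :=
  (Equiv.swap (0 : Fin 2) 1).prodCongr (indSwap n)

/-- The signs attached to the quaternionic structure of `ℂ² ⊗ ℂ[z]`. -/
def blockSign {n : ℕ} (p : Fin 2 × Ind n) : ℂ := (-1) ^ (p.1 : ℕ) * indSign p.2.1

lemma blockSign_mul_self {n : ℕ} (p : Fin 2 × Ind n) : blockSign p * blockSign p = 1 := by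
  rw [blockSign, mul_mul_mul_comm, indSign_mul_self, ← mul_pow]; simp

lemma QuatBlock.symm {n : ℕ} {B : Fin 2 → Fin 2 → Matrix (Ind n) (Ind n) ℂ} (h : QuatBlock B)
    (p q : Fin 2 × Ind n) : blockMatrix B p q =
      blockSign p * blockSign q * conj (blockMatrix B (blockSwap n p) (blockSwap n q)) := by
  have h00 : B 0 0 = matJ (B 1 1) := by rw [h.1, matJ_matJ]
  have h10 : B 1 0 = -matJ (B 0 1) := by rw [h.2, matJ_neg, matJ_matJ, neg_neg]
  obtain ⟨k, a⟩ := p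
  obtain ⟨l, b⟩ := q
  fin_cases k <;> fin_cases l
  · simpa [blockMatrix, matJ, blockSwap, blockSign] using congrFun₂ h00 a b
  · simpa [blockMatrix, matJ, blockSwap, blockSign] using congrFun₂ h.2 a b
  · simpa [blockMatrix, matJ, blockSwap, blockSign] using congrFun₂ h10 a b
  · simpa [blockMatrix, matJ, blockSwap, blockSign] using congrFun₂ h.1 a b

lemma QuatBlock.det_im {n : ℕ} {B : Fin 2 → Fin 2 → Matrix (Ind n) (Ind n) ℂ} (h : QuatBlock B) :
    (blockMatrix B).det.im = 0 :=
  Complex.conj_eq_iff_im.1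
    (Matrix.det_eq_conj_of_symm (blockSwap n) blockSign_mul_self h.symm).symm

lemma QuatBlock.convex {n : ℕ} {B C : Fin 2 → Fin 2 → Matrix (Ind n) (Ind n) ℂ} (hB : QuatBlock B)
    (hC : QuatBlock C) (s t : ℝ) : QuatBlock fun k l => (s : ℂ) • B k l + (t : ℂ) • C k l := by
  constructor
  · change _ + _ = _
    rw [matJ_add, matJ_smul, matJ_smul, hB.1, hC.1, Complex.conj_ofReal, Complex.conj_ofReal]
  · change _ + _ = _
    rw [matJ_add, matJ_smul, matJ_smul, hB.2, hC.2, Complex.conj_ofReal, Complex.conj_ofReal]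
    simp; abel

lemma mono_quatJ {n : ℕ} (α : Ind n) (z : Fin 4 → ℂ) :
    mono (indSwap n α).1 0 (quatJ z) = indSign α.1 * conj (mono α.1 0 z) := by
  simp [mono, Fin.prod_univ_four, indSwap, quatJ, pairSwap_apply, indSign]
  rw [neg_pow (conj (z 1)), neg_pow (conj (z 3))]
  ring

lemma matJ_compress {n : ℕ} {g g' : C(CP3, ℂ)}
    (h : ∀ z, g' (toCP3 z) = conj (g (toCP3 (quatJ z)))) :
    matJ (compress (monoFam n) (toeplitz g)) = compress (monoFam n) (toeplitz g') := by
  ext a b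
  have hf : fac (indSwap n a).1 = fac a.1 := 
    Equiv.prod_comp pairSwap fun i => ((a.1 i).factorial : ℝ)
  simp only [matJ, compress, Matrix.of_apply, monoFam, norm_monoL_sq, hf, map_div₀,
    Complex.conj_ofReal, ← mul_div_assoc]
  congr 1
  simp only [monoL, mulOp_toLp, inner_toLp]
  rw [← integral_conj, ← measurePreserving_quatJ.integral_comp
    (continuous_quatJ.measurableEmbedding quatJ_injective), ← integral_const_mul]
  refine integral_congr_ae (Filter.Eventually.of_forall fun z => ?_)
  have h1 := indSign_mul_self a.1
  have h2 := indSign_mul_self b.1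
  simp only [mono_quatJ, h, map_mul, Complex.conj_conj, conj_indSign]
  linear_combination (conj (mono a.1 0 z) * conj (g (toCP3 (quatJ z))) * mono b.1 0 z) *
    (indSign b.1 * indSign b.1 * h1 + h2)

lemma quatBlock_compress {n : ℕ} {F : Fin 2 → Fin 2 → C(CP3, ℂ)}
    (h : ∀ z, F 1 1 (toCP3 z) = conj (F 0 0 (toCP3 (quatJ z))))
    (h' : ∀ z, F 0 1 (toCP3 z) = -conj (F 1 0 (toCP3 (quatJ z)))) :
    QuatBlock fun k l => compress (monoFam n) (toeplitz (F k l)) := by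
  refine ⟨(matJ_compress h).symm, ?_⟩
  have := matJ_compress (n := n) (g := F 1 0) (g' := -F 0 1) fun z => by simp [h' z]
  rw [this]
  ext a b
  simp [compress, neg_div]

end QuaternionicStructure

section QuantizedSymbol

/-- The matrix of `z_i z_k ∂_j ∂_l` on polynomials of degree `n`. -/
def quadMatrix (n : ℕ) (i j k l : Fin 4) : Matrix (Ind n) (Ind n) ℂ :=
  Matrix.of fun β α => if β.1 + Pi.single j 1 + Pi.single l 1 = α.1 + Pi.single i 1 + Pi.single k 1
    then (α.1 l * (α.1 - Pi.single l 1 : Fin 4 → ℕ) j : ℕ) else 0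

lemma single_le_of_ne_zero {α : Fin 4 → ℕ} {j : Fin 4} (h : α j ≠ 0) :
    (Pi.single j 1 : Fin 4 → ℕ) ≤ α := by
  intro m
  by_cases hmj : m = j
  · subst hmj; simp; omega
  · simp [hmj]

lemma shiftMatrix_mul (n : ℕ) {i j k l : Fin 4} (h : j ≠ k) :
    shiftMatrix n i j * shiftMatrix n k l = quadMatrix n i j k l := by
  ext β α
  rw [Matrix.mul_apply]
  by_cases ha : α.1 l = 0
  · simp [shiftMatrix, quadMatrix, ha]
  have hle := single_le_of_ne_zero ha
  have hmem : ∑ m, (α.1 - Pi.single l 1 + Pi.single k 1 : Fin 4 → ℕ) m = n := by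
    have h1 : ∑ m, ((α.1 - Pi.single l 1) + Pi.single l 1 : Fin 4 → ℕ) m = n := by
      rw [tsub_add_cancel_of_le hle]; exact α.2
    simp only [Pi.add_apply, Finset.sum_add_distrib, Finset.sum_pi_single'] at h1 ⊢
    simpa using h1
  rw [Finset.sum_eq_single ⟨_, hmem⟩]
  · have h1 : α.1 - Pi.single l 1 + Pi.single k 1 + Pi.single l 1 = α.1 + Pi.single k 1 := by
      rw [add_right_comm, tsub_add_cancel_of_le hle]
    have h2 : β.1 + Pi.single j 1 = α.1 - Pi.single l 1 + Pi.single k 1 + Pi.single i 1 ↔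
        β.1 + Pi.single j 1 + Pi.single l 1 = α.1 + Pi.single i 1 + Pi.single k 1 := by
      rw [← add_left_inj (Pi.single l 1), add_right_comm _ (Pi.single i 1), h1,
        add_right_comm _ (Pi.single k 1)]
    simp only [shiftMatrix, quadMatrix, Matrix.of_apply, h1, if_true, h2]
    split_ifs
    · simp [h]; ring
    · simp
  · intro γ _ hγ
    refine mul_eq_zero_of_right _ (if_neg fun h => ?_)
    refine hγ (Subtype.ext ?_)
    rw [← tsub_add_cancel_of_le hle, add_right_comm] at h
    exact add_right_cancel h
  · simp

lemma quadMatrix_comm (n : ℕ) (i j k l : Fin 4) : quadMatrix n i j k l = quadMatrix n k l i j := by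
  ext β α
  have : α.1 l * (α.1 - Pi.single l 1 : Fin 4 → ℕ) j = α.1 j * (α.1 - Pi.single j 1 : Fin 4 → ℕ) l := by
    by_cases h : j = l
    · rw [h]
    · simp [h, Ne.symm h, mul_comm]
  simp only [quadMatrix, Matrix.of_apply, this, add_right_comm _ (Pi.single j 1),
    add_right_comm _ (Pi.single i 1)]

lemma shiftMatrix_comm (n : ℕ) {i j k l : Fin 4} (h : j ≠ k) (h' : l ≠ i) :
    shiftMatrix n i j * shiftMatrix n k l = shiftMatrix n k l * shiftMatrix n i j := by
  rw [shiftMatrix_mul n h, shiftMatrix_mul n h', quadMatrix_comm]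

/-- The matrix `diag(-i, i) (2 r + i (2 v v* - |v|²))`, as a noncommutative polynomial in the matrix
entries of a point of projective space. -/
def symbolPoly {R : Type*} [Ring R] [Algebra ℂ R] (e : Fin 4 → Fin 4 → R) : Fin 2 → Fin 2 → R :=
  let d := (2 * Complex.I) • (e 0 0 + e 1 1 - e 2 2 - e 3 3)
  let a := (4 : ℂ) • ((e 0 0 - e 1 1) * (e 2 2 - e 3 3)) + (8 : ℂ) • (e 0 2 * e 1 3) +
    (8 : ℂ) • (e 2 0 * e 3 1)
  ![![a - d, (8 : ℂ) • (e 0 1 * (e 2 2 - e 3 3)) + (8 : ℂ) • (e 2 1 * e 3 1) -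
      (8 : ℂ) • (e 0 2 * e 0 3)],
    ![(8 : ℂ) • (e 2 0 * e 3 0) - (8 : ℂ) • (e 1 0 * (e 2 2 - e 3 3)) -
      (8 : ℂ) • (e 1 2 * e 1 3), a + d]]

/-- The quantization of the symbol in degree `n`. -/
def symbolMatrix (n : ℕ) : Fin 2 → Fin 2 → Matrix (Ind n) (Ind n) ℂ :=
  symbolPoly fun i j => ((n : ℂ) + 4)⁻¹ • shiftMatrix n i j

lemma quantizes_symbolMatrix (k l : Fin 2) :
    Quantizes toeplitz monoFam (symbolPoly gen k l) (fun n => symbolMatrix n k l) := by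
  have g := quantizes_gen
  have hd := ((((g 0 0).add (g 1 1)).sub (g 2 2)).sub (g 3 3)).smul (2 * Complex.I)
  have ha := (((((g 0 0).sub (g 1 1)).mul ((g 2 2).sub (g 3 3))).smul 4).add
    (((g 0 2).mul (g 1 3)).smul 8)).add (((g 2 0).mul (g 3 1)).smul 8)
  fin_cases k <;> fin_cases l
  · exact ha.sub hd
  · exact ((((g 0 1).mul ((g 2 2).sub (g 3 3))).smul 8).add (((g 2 1).mul (g 3 1)).smul 8)).sub
      (((g 0 2).mul (g 0 3)).smul 8)
  · exact ((((g 2 0).mul (g 3 0)).smul 8).sub (((g 1 0).mul ((g 2 2).sub (g 3 3))).smul 8)).sub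
      (((g 1 2).mul (g 1 3)).smul 8)
  · exact ha.add hd

lemma quatBlock_symbolMatrix (n : ℕ) : QuatBlock (symbolMatrix n) := by
  have hc : conj (((n : ℂ) + 4)⁻¹) = ((n : ℂ) + 4)⁻¹ := by
    rw [map_inv₀, map_add, Complex.conj_natCast, Complex.conj_ofNat]
  have h1 := shiftMatrix_comm n (i := 0) (j := 2) (k := 1) (l := 3) (by decide) (by decide)
  have h2 := shiftMatrix_comm n (i := 2) (j := 0) (k := 3) (l := 1) (by decide) (by decide)
  have h3 := shiftMatrix_comm n (i := 3) (j := 1) (k := 2) (l := 1) (by decide) (by decide)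
  have h4 := shiftMatrix_comm n (i := 0) (j := 3) (k := 0) (l := 2) (by decide) (by decide)
  constructor
  · simp [symbolMatrix, symbolPoly, matJ_add, matJ_sub, matJ_smul, matJ_mul, matJ_shiftMatrix,
      pairSwap_apply, Complex.conj_ofNat, h1, h2, mul_sub, sub_mul]
    module
  · simp [symbolMatrix, symbolPoly, matJ_sub, matJ_smul, matJ_mul, matJ_shiftMatrix,
      pairSwap_apply, Complex.conj_ofNat, h3, h4, mul_sub, sub_mul]
    module

end QuantizedSymbol

section WeightDecomposition

/-- The first weight of a basis vector of `ℂ² ⊗ ℂ[z]`. -/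
def weightA {n : ℕ} (p : Fin 2 × Ind n) : ℤ := p.2.1 0 - p.2.1 1 + 2 * (p.1 : ℕ) - 1

/-- The second weight of a basis vector of `ℂ² ⊗ ℂ[z]`. -/
def weightB {n : ℕ} (p : Fin 2 × Ind n) : ℤ := p.2.1 2 - p.2.1 3

lemma symbolMatrix_zero_zero (n : ℕ) : symbolMatrix n 0 0 = (((n : ℂ) + 4)⁻¹ ^ 2) •
    ((4 : ℂ) • (quadMatrix n 0 0 2 2 - quadMatrix n 0 0 3 3 - quadMatrix n 1 1 2 2 +
      quadMatrix n 1 1 3 3) + (8 : ℂ) • (quadMatrix n 0 2 1 3 + quadMatrix n 2 0 3 1)) -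
    (2 * Complex.I * ((n : ℂ) + 4)⁻¹) • (shiftMatrix n 0 0 + shiftMatrix n 1 1 -
      shiftMatrix n 2 2 - shiftMatrix n 3 3) := by
  simp only [symbolMatrix, symbolPoly]
  generalize ((n : ℂ) + 4)⁻¹ = c
  simp [mul_sub, sub_mul, shiftMatrix_mul]
  module

lemma symbolMatrix_one_one (n : ℕ) : symbolMatrix n 1 1 = (((n : ℂ) + 4)⁻¹ ^ 2) •
    ((4 : ℂ) • (quadMatrix n 0 0 2 2 - quadMatrix n 0 0 3 3 - quadMatrix n 1 1 2 2 +
      quadMatrix n 1 1 3 3) + (8 : ℂ) • (quadMatrix n 0 2 1 3 + quadMatrix n 2 0 3 1)) +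
    (2 * Complex.I * ((n : ℂ) + 4)⁻¹) • (shiftMatrix n 0 0 + shiftMatrix n 1 1 -
      shiftMatrix n 2 2 - shiftMatrix n 3 3) := by
  simp only [symbolMatrix, symbolPoly]
  generalize ((n : ℂ) + 4)⁻¹ = c
  simp [mul_sub, sub_mul, shiftMatrix_mul]
  module

lemma symbolMatrix_zero_one (n : ℕ) : symbolMatrix n 0 1 = (((n : ℂ) + 4)⁻¹ ^ 2) •
    ((8 : ℂ) • (quadMatrix n 0 1 2 2 - quadMatrix n 0 1 3 3 + quadMatrix n 2 1 3 1 -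
      quadMatrix n 0 2 0 3)) := by
  simp only [symbolMatrix, symbolPoly]
  generalize ((n : ℂ) + 4)⁻¹ = c
  simp [mul_sub, shiftMatrix_mul]
  module

lemma symbolMatrix_one_zero (n : ℕ) : symbolMatrix n 1 0 = (((n : ℂ) + 4)⁻¹ ^ 2) •
    ((8 : ℂ) • (quadMatrix n 2 0 3 0 - quadMatrix n 1 0 2 2 + quadMatrix n 1 0 3 3 -
      quadMatrix n 1 2 1 3)) := by
  simp only [symbolMatrix, symbolPoly]
  generalize ((n : ℂ) + 4)⁻¹ = c
  simp [mul_sub, shiftMatrix_mul]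
  module

lemma shiftMatrix_eq_zero {n : ℕ} {i j : Fin 4} {β α : Ind n}
    (h : ¬ ∀ m, (β.1 + Pi.single j 1 : Fin 4 → ℕ) m = (α.1 + Pi.single i 1 : Fin 4 → ℕ) m) :
    shiftMatrix n i j β α = 0 :=
  if_neg fun h' => h (congrFun h')

lemma quadMatrix_eq_zero {n : ℕ} {i j k l : Fin 4} {β α : Ind n}
    (h : ¬ ∀ m, (β.1 + Pi.single j 1 + Pi.single l 1 : Fin 4 → ℕ) m =
      (α.1 + Pi.single i 1 + Pi.single k 1 : Fin 4 → ℕ) m) :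
    quadMatrix n i j k l β α = 0 :=
  if_neg fun h' => h (congrFun h')

lemma symbolMatrix_eq_zero {n : ℕ} {p q : Fin 2 × Ind n}
    (h : ¬ (weightA p = weightA q ∧ weightB p = weightB q)) :
    blockMatrix (symbolMatrix n) p q = 0 := by
  obtain ⟨k, β⟩ := p
  obtain ⟨l, α⟩ := q
  simp only [weightA, weightB] at h
  have key : ∀ {i j k l : Fin 4}, (¬ ∀ m, (β.1 + Pi.single j 1 + Pi.single l 1 : Fin 4 → ℕ) m =
      (α.1 + Pi.single i 1 + Pi.single k 1 : Fin 4 → ℕ) m) → quadMatrix n i j k l β α = 0 :=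
    quadMatrix_eq_zero
  have key' : ∀ {i j : Fin 4}, (¬ ∀ m, (β.1 + Pi.single j 1 : Fin 4 → ℕ) m =
      (α.1 + Pi.single i 1 : Fin 4 → ℕ) m) → shiftMatrix n i j β α = 0 :=
    shiftMatrix_eq_zero
  fin_cases k <;> fin_cases l <;> simp at h <;> simp only [blockMatrix, Matrix.of_apply]
  · change symbolMatrix n 0 0 β α = 0
    rw [symbolMatrix_zero_zero]
    simp only [Matrix.sub_apply, Matrix.add_apply, Matrix.smul_apply]
    iterate 6 rw [key]
    iterate 4 rw [key']
    · simp
    all_goals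
      intro h'
      simp [Fin.forall_fin_succ] at h'
      omega
  · change symbolMatrix n 0 1 β α = 0
    rw [symbolMatrix_zero_one]
    simp only [Matrix.sub_apply, Matrix.add_apply, Matrix.smul_apply]
    iterate 4 rw [key]
    · simp
    all_goals
      intro h'
      simp [Fin.forall_fin_succ] at h'
      omega
  · change symbolMatrix n 1 0 β α = 0
    rw [symbolMatrix_one_zero]
    simp only [Matrix.sub_apply, Matrix.add_apply, Matrix.smul_apply]
    iterate 4 rw [key]
    · simp
    all_goals
      intro h'
      simp [Fin.forall_fin_succ] at h'
      omega
  · change symbolMatrix n 1 1 β α = 0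
    rw [symbolMatrix_one_one]
    simp only [Matrix.sub_apply, Matrix.add_apply, Matrix.smul_apply]
    iterate 6 rw [key]
    iterate 4 rw [key']
    · simp
    all_goals
      intro h'
      simp [Fin.forall_fin_succ] at h'
      omega

/-- The sign of the weight of a basis vector, in lexicographic order. -/
def weightSign {n : ℕ} (p : Fin 2 × Ind n) : SignType :=
  SignType.sign (if weightB p = 0 then weightA p else weightB p)

lemma weightSign_blockSwap {n : ℕ} (p : Fin 2 × Ind n) :
    weightSign (blockSwap n p) = -weightSign p := by
  obtain ⟨k, α⟩ := p
  have h0 : pairSwap 0 = 1 := by decide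
  have h1 : pairSwap 1 = 0 := by decide
  have h2 : pairSwap 2 = 3 := by decide
  have h3 : pairSwap 3 = 2 := by decide
  have hB : weightB (blockSwap n (k, α)) = -weightB (k, α) := by
    simp [weightB, blockSwap, indSwap, h2, h3]
  have hA : weightA (blockSwap n (k, α)) = -weightA (k, α) := by
    fin_cases k <;> simp [weightA, blockSwap, indSwap, h0, h1] <;> omega
  simp only [weightSign, hA, hB, neg_eq_zero]
  rw [← Left.sign_neg]
  split_ifs <;> rfl

lemma weightSign_eq_zero_iff {n : ℕ} (p : Fin 2 × Ind n) :
    weightSign p = 0 ↔ weightA p = 0 ∧ weightB p = 0 := by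
  rw [weightSign, sign_eq_zero_iff]
  split_ifs with h <;> simp [h]

/-- The block of the quantized symbol of zero weight. -/
def zeroBlock (n : ℕ) : Matrix {p : Fin 2 × Ind n // weightSign p = 0}
    {p : Fin 2 × Ind n // weightSign p = 0} ℂ :=
  (blockMatrix (symbolMatrix n)).toSquareBlock weightSign 0

lemma det_symbolMatrix_eq (n : ℕ) : ∃ r : ℝ, 0 ≤ r ∧
    (blockMatrix (symbolMatrix n)).det = (r : ℂ) * (zeroBlock n).det := by
  set M := blockMatrix (symbolMatrix n) with hM
  have hT : M.BlockTriangular (weightSign (n := n)) := by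
    intro p q hpq
    refine symbolMatrix_eq_zero fun h => hpq.ne ?_
    simp only [weightSign, h.1, h.2]
  have hneg : (M.toSquareBlock weightSign 1).det =
      conj (M.toSquareBlock weightSign (-1)).det := by
    refine Matrix.det_eq_conj_of_symm ((blockSwap n).subtypeEquiv fun p => ?_)
      (s := fun p => blockSign p.1) (fun p => blockSign_mul_self p.1) fun p q => ?_
    · rw [weightSign_blockSwap, neg_inj]
    · exact (quatBlock_symbolMatrix n).symm p.1 q.1
  refine ⟨Complex.normSq (M.toSquareBlock weightSign (-1)).det, Complex.normSq_nonneg _, ?_⟩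
  rw [hT.det_fintype, SignType.univ_eq]
  rw [Finset.prod_insert (by decide), Finset.prod_insert (by decide), Finset.prod_singleton]
  rw [hneg, Complex.normSq_eq_conj_mul_self]
  change (zeroBlock n).det * _ = _
  ring

end WeightDecomposition

section ZeroBlock

/-- The matrix sending the basis vector `i` to `u i` times the basis vector `i + 1`. -/
def raising (h : ℕ) (u : ℕ → ℂ) : Matrix (Fin (h + 1)) (Fin (h + 1)) ℂ :=
  Matrix.of fun i j => if (i : ℕ) = j + 1 then u j else 0

/-- The matrix sending the basis vector `i` to `u i` times the basis vector `i - 1`. -/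
def lowering (h : ℕ) (u : ℕ → ℂ) : Matrix (Fin (h + 1)) (Fin (h + 1)) ℂ :=
  Matrix.of fun i j => if (i : ℕ) + 1 = j then u j else 0

lemma lowering_mul_diagonal_mul_raising (h : ℕ) (u l d : ℕ → ℂ) :
    lowering h l * Matrix.diagonal (fun i : Fin (h + 1) => d i) * raising h u =
      Matrix.diagonal fun i : Fin (h + 1) =>
        if (i : ℕ) = h then 0 else l (i + 1) * d (i + 1) * u i := by
  ext i j
  rw [Matrix.mul_apply, Matrix.diagonal_apply]
  simp only [Matrix.mul_diagonal, lowering, raising, Matrix.of_apply]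
  by_cases hj : (j : ℕ) = h
  · rw [Finset.sum_eq_zero]
    · split_ifs with h1 h2 <;> first | rfl | (subst h1; exact absurd hj h2)
    · intro k _
      rw [if_neg (c := (k : ℕ) = j + 1) (by omega), mul_zero]
  · have hjk : (j : ℕ) + 1 < h + 1 := by omega
    rw [Finset.sum_eq_single ⟨j + 1, hjk⟩]
    · simp only [add_left_inj, Fin.val_inj, if_true]
      by_cases hij : i = j
      · subst hij; simp [hj]
      · simp [hij]
    · intro k _ hk
      rw [if_neg (c := (k : ℕ) = j + 1) (fun h' => hk (Fin.ext h')), mul_zero]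
    · simp

lemma det_fromBlocks_raising_lowering (h : ℕ) (d u l : ℕ → ℂ) (hd : ∀ i ≤ h, d i ≠ 0) :
    (Matrix.fromBlocks (Matrix.diagonal fun i : Fin (h + 1) => d i) (raising h u) (lowering h l)
      (Matrix.diagonal fun i : Fin (h + 1) => d i)).det =
      d 0 * d h * ∏ i ∈ Finset.range h, (d i * d (i + 1) - u i * l (i + 1)) := by
  have hd' : ∀ i : Fin (h + 1), d i ≠ 0 := fun i => hd i (by omega)
  have : Invertible (Matrix.diagonal fun i : Fin (h + 1) => d i) :=
    Matrix.invertibleOfIsUnitDet _ (by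
      rw [Matrix.det_diagonal, isUnit_iff_ne_zero]
      exact Finset.prod_ne_zero_iff.2 fun i _ => hd' i)
  have hinv : ⅟(Matrix.diagonal fun i : Fin (h + 1) => d i) =
      Matrix.diagonal fun i : Fin (h + 1) => (d i)⁻¹ := by
    refine invOf_eq_right_inv ?_
    rw [Matrix.diagonal_mul_diagonal]
    simp [hd']
  rw [Matrix.det_fromBlocks₁₁, hinv, lowering_mul_diagonal_mul_raising h u l fun i => (d i)⁻¹,
    Matrix.diagonal_sub, Matrix.det_diagonal, Matrix.det_diagonal, Fin.prod_univ_succ,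
    Fin.prod_univ_castSucc (n := h)]
  simp only [Fin.val_zero, Fin.val_succ, Fin.val_castSucc, Fin.val_last, if_true, sub_zero]
  rw [← Fin.prod_univ_eq_prod_range (fun i => d i * d (i + 1) - u i * l (i + 1)),
    mul_mul_mul_comm, mul_comm (∏ i : Fin h, _) (d h), mul_assoc (d 0), mul_assoc (d 0),
    mul_left_comm _ (d h), ← Finset.prod_mul_distrib]
  congr 2
  refine Finset.prod_congr rfl fun i _ => ?_
  have h1 := hd (i + 1) (by omega)
  rw [if_neg (by omega)]
  field_simp

/-- Reordering of the zero weight vectors. -/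
def zeroWeightEquiv (h : ℕ) : Fin (h + 1) ⊕ Fin (h + 1) ≃
    {p : Fin 2 × Ind (2 * h + 1) // weightSign p = 0} where
  toFun := Sum.elim
    (fun i => ⟨(0, ⟨![i + 1, i, h - i, h - i], by simp [Fin.sum_univ_four]; omega⟩), by
      simp [weightSign_eq_zero_iff, weightA, weightB]⟩)
    (fun i => ⟨(1, ⟨![i, i + 1, h - i, h - i], by simp [Fin.sum_univ_four]; omega⟩), by
      simp [weightSign_eq_zero_iff, weightA, weightB]⟩)
  invFun p := if p.1.1 = 0 then Sum.inl (Fin.ofNat (h + 1) (p.1.2.1 1))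
    else Sum.inr (Fin.ofNat (h + 1) (p.1.2.1 0))
  left_inv := by
    rintro (i | i) <;> simp
  right_inv := by
    rintro ⟨⟨k, α, hα⟩, hp⟩
    rw [Fin.sum_univ_four] at hα
    simp only [weightSign_eq_zero_iff, weightA, weightB] at hp
    obtain ⟨hp, hp'⟩ := hp
    refine Subtype.ext (Prod.ext ?_ (Subtype.ext (funext fun m => ?_)))
    · fin_cases k <;> simp
    · fin_cases k <;> fin_cases m <;> simp at hp hp' ⊢ <;>
        (try rw [Nat.mod_eq_of_lt]) <;> omega

lemma quadMatrix_eq_ite {n : ℕ} {i j k l : Fin 4} {β α : Ind n} {c : Prop} [Decidable c] {v : ℕ}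
    (hc : (∀ m, β.1 m + (if m = j then 1 else 0) + (if m = l then 1 else 0) =
      α.1 m + (if m = i then 1 else 0) + (if m = k then 1 else 0)) ↔ c)
    (hv : α.1 l * (α.1 j - if j = l then 1 else 0) = v) :
    quadMatrix n i j k l β α = if c then (v : ℂ) else 0 := by
  simp only [← Pi.single_apply] at hc hv
  rw [← hv]
  exact if_congr (funext_iff.trans hc) rfl rfl

lemma shiftMatrix_eq_ite {n : ℕ} {i j : Fin 4} {β α : Ind n} {c : Prop} [Decidable c] {v : ℕ}
    (hc : (∀ m, β.1 m + (if m = j then 1 else 0) = α.1 m + (if m = i then 1 else 0)) ↔ c)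
    (hv : α.1 j = v) :
    shiftMatrix n i j β α = if c then (v : ℂ) else 0 := by
  simp only [← Pi.single_apply] at hc
  rw [← hv]
  exact if_congr (funext_iff.trans hc) rfl rfl

lemma zeroBlock_submatrix (h : ℕ) {c : ℂ} (hc : (((2 * h + 1 : ℕ) : ℂ) + 4)⁻¹ = c)
    {U L D : Matrix (Fin (h + 1)) (Fin (h + 1)) ℂ} (hU : U = raising h fun i => ((h - i) ^ 2 : ℕ))
    (hL : L = lowering h fun i => (i * (i + 1) : ℕ))
    (hD : D = Matrix.diagonal fun i : Fin (h + 1) => (4 * (i : ℂ) + 1 - 2 * h)) :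
    (zeroBlock (2 * h + 1)).submatrix (zeroWeightEquiv h) (zeroWeightEquiv h) =
      Matrix.fromBlocks ((8 * c ^ 2) • (U + L) - (2 * Complex.I * c) • D) ((8 * c ^ 2) • (L - U))
        ((8 * c ^ 2) • (L - U)) ((8 * c ^ 2) • (U + L) + (2 * Complex.I * c) • D) := by
  replace hD : ∀ i j, D i j = if i = j then ((j + 1 : ℕ) : ℂ) + (j : ℕ) - 2 * (h - j : ℕ)
      else 0 := fun i j => by
    rw [hD, Matrix.diagonal_apply, Nat.cast_sub (by omega)]
    split_ifs with hij
    · subst hij; push_cast; ring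
    · rfl
  replace hU : ∀ i j : Fin (h + 1), U i j =
    if (i : ℕ) = j + 1 then (((h - j) ^ 2 : ℕ) : ℂ) else 0 := fun _ _ => by rw [hU]; rfl
  replace hL : ∀ i j : Fin (h + 1), L i j =
    if (i : ℕ) + 1 = j then ((j * (j + 1) : ℕ) : ℂ) else 0 := fun _ _ => by rw [hL]; rfl
  ext (i | i) (j | j)
  · refine (congrFun₂ (symbolMatrix_zero_zero (2 * h + 1))
      ⟨![i + 1, i, h - i, h - i], by simp [Fin.sum_univ_four]; omega⟩
      ⟨![j + 1, j, h - j, h - j], by simp [Fin.sum_univ_four]; omega⟩).trans ?_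
    simp only [Matrix.sub_apply, Matrix.add_apply, Matrix.smul_apply, Matrix.fromBlocks_apply₁₁, hU,
      hL, hD]
    rw [hc, quadMatrix_eq_ite (c := i = j) (v := (h - j) * (j + 1)),
      quadMatrix_eq_ite (c := i = j) (v := (h - j) * (j + 1)),
      quadMatrix_eq_ite (c := i = j) (v := (h - j) * j),
      quadMatrix_eq_ite (c := i = j) (v := (h - j) * j),
      quadMatrix_eq_ite (c := (i : ℕ) = j + 1) (v := (h - j) * (h - j)),
      quadMatrix_eq_ite (c := (i : ℕ) + 1 = j) (v := j * (j + 1)),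
      shiftMatrix_eq_ite (c := i = j) (v := j + 1),
      shiftMatrix_eq_ite (c := i = j) (v := j),
      shiftMatrix_eq_ite (c := i = j) (v := h - j),
      shiftMatrix_eq_ite (c := i = j) (v := h - j)]
    · split_ifs <;> try omega
      all_goals simp only [smul_eq_mul]; push_cast; ring
    all_goals simp [Fin.forall_fin_succ]; (try rw [← Fin.val_inj]); try omega
  · refine (congrFun₂ (symbolMatrix_zero_one (2 * h + 1))
      ⟨![i + 1, i, h - i, h - i], by simp [Fin.sum_univ_four]; omega⟩
      ⟨![j, j + 1, h - j, h - j], by simp [Fin.sum_univ_four]; omega⟩).trans ?_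
    simp only [Matrix.sub_apply, Matrix.add_apply, Matrix.smul_apply, Matrix.fromBlocks_apply₁₂, hU,
      hL]
    rw [hc, quadMatrix_eq_ite (c := i = j) (v := (h - j) * (j + 1)),
      quadMatrix_eq_ite (c := i = j) (v := (h - j) * (j + 1)),
      quadMatrix_eq_ite (c := (i : ℕ) + 1 = j) (v := (j + 1) * j),
      quadMatrix_eq_ite (c := (i : ℕ) = j + 1) (v := (h - j) * (h - j))]
    · split_ifs <;> try omega
      all_goals simp only [smul_eq_mul]; push_cast; ring
    all_goals simp [Fin.forall_fin_succ]; (try rw [← Fin.val_inj]); try omega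
  · refine (congrFun₂ (symbolMatrix_one_zero (2 * h + 1))
      ⟨![i, i + 1, h - i, h - i], by simp [Fin.sum_univ_four]; omega⟩
      ⟨![j + 1, j, h - j, h - j], by simp [Fin.sum_univ_four]; omega⟩).trans ?_
    simp only [Matrix.sub_apply, Matrix.add_apply, Matrix.smul_apply, Matrix.fromBlocks_apply₂₁, hU,
      hL]
    rw [hc, quadMatrix_eq_ite (c := (i : ℕ) + 1 = j) (v := (j + 1) * j),
      quadMatrix_eq_ite (c := i = j) (v := (h - j) * (j + 1)),
      quadMatrix_eq_ite (c := i = j) (v := (h - j) * (j + 1)),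
      quadMatrix_eq_ite (c := (i : ℕ) = j + 1) (v := (h - j) * (h - j))]
    · split_ifs <;> try omega
      all_goals simp only [smul_eq_mul]; push_cast; ring
    all_goals simp [Fin.forall_fin_succ]; (try rw [← Fin.val_inj]); try omega
  · refine (congrFun₂ (symbolMatrix_one_one (2 * h + 1))
      ⟨![i, i + 1, h - i, h - i], by simp [Fin.sum_univ_four]; omega⟩
      ⟨![j, j + 1, h - j, h - j], by simp [Fin.sum_univ_four]; omega⟩).trans ?_
    simp only [Matrix.sub_apply, Matrix.add_apply, Matrix.smul_apply, Matrix.fromBlocks_apply₂₂, hU,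
      hL, hD]
    rw [hc, quadMatrix_eq_ite (c := i = j) (v := (h - j) * j),
      quadMatrix_eq_ite (c := i = j) (v := (h - j) * j),
      quadMatrix_eq_ite (c := i = j) (v := (h - j) * (j + 1)),
      quadMatrix_eq_ite (c := i = j) (v := (h - j) * (j + 1)),
      quadMatrix_eq_ite (c := (i : ℕ) = j + 1) (v := (h - j) * (h - j)),
      quadMatrix_eq_ite (c := (i : ℕ) + 1 = j) (v := (j + 1) * j),
      shiftMatrix_eq_ite (c := i = j) (v := j),
      shiftMatrix_eq_ite (c := i = j) (v := j + 1),
      shiftMatrix_eq_ite (c := i = j) (v := h - j),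
      shiftMatrix_eq_ite (c := i = j) (v := h - j)]
    · split_ifs <;> try omega
      all_goals simp only [smul_eq_mul]; push_cast; ring
    all_goals simp [Fin.forall_fin_succ]; (try rw [← Fin.val_inj]); try omega

lemma det_zeroBlock (h : ℕ) {c : ℝ} (hc : c = (((2 * h + 1 : ℕ) : ℝ) + 4)⁻¹) {d : ℕ → ℝ}
    (hd : ∀ i : ℕ, d i = 2 * c * (4 * i + 1 - 2 * h)) :
    (zeroBlock (2 * h + 1)).det = ((d 0 * d h * ∏ i ∈ Finset.range h,
      (d i * d (i + 1) + 256 * c ^ 4 * ((h - i : ℕ) ^ 2 * ((i + 1) * (i + 2)))) : ℝ) : ℂ) := by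
  have hc0 : c ≠ 0 := by rw [hc]; positivity
  set κ : ℂ := 8 * Complex.I * (c : ℂ) ^ 2 with hκ
  have hκ2 : κ ^ 2 = -64 * (c : ℂ) ^ 4 := by rw [hκ]; ring_nf; rw [Complex.I_sq]; ring
  set u : ℕ → ℂ := fun i => 2 * κ * ((h - i) ^ 2 : ℕ) with hu
  set l : ℕ → ℂ := fun i => 2 * κ * (i * (i + 1) : ℕ) with hl
  have hd0 : ∀ i, d i ≠ 0 := fun i => by
    rw [hd]
    refine mul_ne_zero (mul_ne_zero two_ne_zero hc0) fun h0 => ?_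
    have : (4 * i + 1 : ℝ) = 2 * h := by linarith
    norm_cast at this
    omega
  have key := det_fromBlocks_raising_lowering h (fun i => (d i : ℂ)) u l
    fun i _ => Complex.ofReal_ne_zero.2 (hd0 i)
  set U := raising h fun i => ((h - i) ^ 2 : ℕ) with hU
  set L := lowering h fun i => (i * (i + 1) : ℕ) with hL
  set D := Matrix.diagonal fun i : Fin (h + 1) => (4 * (i : ℂ) + 1 - 2 * h) with hD
  have hZ := zeroBlock_submatrix h (c := (c : ℂ)) (by rw [hc]; push_cast; rfl) hU hL hD
  have hu' : raising h u = (2 * κ) • U := by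
    ext i j; simp [raising, hU, hu]
  have hl' : lowering h l = (2 * κ) • L := by
    ext i j; simp [lowering, hL, hl]
  have hd' : (Matrix.diagonal fun i : Fin (h + 1) => (d i : ℂ)) = (2 * (c : ℂ)) • D := by
    rw [hD, ← Matrix.diagonal_smul]
    congr 1; ext i; simp [hd]
  rw [hu', hl', hd'] at key
  set X : Matrix (Fin (h + 1) ⊕ Fin (h + 1)) (Fin (h + 1) ⊕ Fin (h + 1)) ℂ :=
    Matrix.fromBlocks 1 1 1 (-1) with hX
  have hdetX : X.det ≠ 0 := by
    rw [hX, Matrix.det_fromBlocks_one₁₁, Matrix.one_mul,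
      show (-1 - 1 : Matrix (Fin (h + 1)) (Fin (h + 1)) ℂ) = (-2 : ℂ) • 1 by module,
      Matrix.det_smul, Matrix.det_one]
    simp
  have hconj : Matrix.fromBlocks (Complex.I • 1) 0 0 (-Complex.I • 1) *
      (zeroBlock (2 * h + 1)).submatrix (zeroWeightEquiv h) (zeroWeightEquiv h) * X = X *
      Matrix.fromBlocks ((2 * (c : ℂ)) • D) ((2 * κ) • U) ((2 * κ) • L) ((2 * (c : ℂ)) • D) := by
    have hI : Complex.I * (2 * Complex.I * (c : ℂ)) = - (2 * c) := by
      linear_combination 2 * (c : ℂ) * Complex.I_mul_I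
    rw [hZ, hX, hκ, Matrix.fromBlocks_multiply, Matrix.fromBlocks_multiply,
      Matrix.fromBlocks_multiply]
    congr 1 <;> simp [smul_sub, smul_add, smul_smul, hI] <;> module
  have hdet := congrArg Matrix.det hconj
  rw [Matrix.det_mul, Matrix.det_mul, Matrix.det_mul, Matrix.det_submatrix_equiv_self,
    Matrix.det_fromBlocks_zero₂₁, Matrix.det_smul, Matrix.det_smul, Matrix.det_one, mul_one, mul_one,
    ← mul_pow, mul_neg, Complex.I_mul_I, neg_neg, Fintype.card_fin, one_pow, one_mul, key,
    mul_comm] at hdet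
  rw [mul_left_cancel₀ hdetX hdet]
  push_cast
  congr 1
  refine Finset.prod_congr rfl fun i _ => ?_
  rw [hu, hl]
  push_cast
  linear_combination (-4 * ((h - i : ℕ) : ℂ) ^ 2 * ((i + 1) * (i + 2))) * hκ2

lemma det_zeroBlock_neg {h : ℕ} (h2 : 2 ≤ h) :
    ∃ r : ℝ, r < 0 ∧ (zeroBlock (2 * h + 1)).det = (r : ℂ) := by
  set c : ℝ := (((2 * h + 1 : ℕ) : ℝ) + 4)⁻¹ with hc
  have hc0 : 0 < c := by rw [hc]; positivity
  refine ⟨_, ?_, det_zeroBlock h hc (d := fun i => 2 * c * (4 * i + 1 - 2 * h)) fun i => rfl⟩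
  have hh : (2 : ℝ) ≤ h := by exact_mod_cast h2
  refine mul_neg_of_neg_of_pos (mul_neg_of_neg_of_pos ?_ ?_) (Finset.prod_pos fun i hi => ?_)
  · push_cast; exact mul_neg_of_pos_of_neg (by positivity) (by linarith)
  · exact mul_pos (by positivity) (by linarith)
  · rw [Finset.mem_range] at hi
    have hn : c * (2 * h + 5) = 1 := by
      rw [hc, show (((2 * h + 1 : ℕ) : ℝ) + 4) = 2 * h + 5 by push_cast; ring]
      exact inv_mul_cancel₀ (by positivity)
    have hj : (1 : ℝ) ≤ (h - i : ℕ) := by exact_mod_cast (by omega : 1 ≤ h - i)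
    have hfac : ∀ x : ℝ, 2 * c * (4 * i + 1 - 2 * h) * (2 * c * (4 * ((i + 1 : ℕ) : ℝ) + 1 - 2 * h)) +
        256 * c ^ 4 * x = 4 * c ^ 4 * ((4 * i + 1 - 2 * h) * (4 * i + 5 - 2 * h) * (2 * h + 5) ^ 2 +
          64 * x) := fun x => by
      have : c ^ 4 * (2 * h + 5) ^ 2 = c ^ 2 := by
        linear_combination c ^ 2 * (c * (2 * h + 5) + 1) * hn
      push_cast
      linear_combination (-4 * ((4 * i + 1 - 2 * h) * (4 * i + 5 - 2 * h))) * this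
    rw [hfac]
    refine mul_pos (by positivity) ?_
    have hpos : (0 : ℝ) < 64 * ((h - i : ℕ) ^ 2 * ((i + 1) * (i + 2))) := by positivity
    rcases (by omega : 4 * i + 6 ≤ 2 * h ∨ h = 2 * i + 2 ∨ h = 2 * i + 1 ∨ 2 * h ≤ 4 * i)
      with h1 | h1 | h1 | h1
    · have h1' : (4 * i + 6 : ℝ) ≤ 2 * h := by exact_mod_cast h1
      exact add_pos_of_nonneg_of_pos (mul_nonneg (mul_nonneg_of_nonpos_of_nonpos (by linarith)
        (by linarith)) (by positivity)) hpos
    · rw [h1, show 2 * i + 2 - i = i + 2 by omega]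
      push_cast
      ring_nf
      nlinarith [(by positivity : (0 : ℝ) ≤ i), (by positivity : (0 : ℝ) ≤ (i : ℝ) ^ 2),
        (by positivity : (0 : ℝ) ≤ (i : ℝ) ^ 3), (by positivity : (0 : ℝ) ≤ (i : ℝ) ^ 4)]
    · obtain ⟨k, rfl⟩ : ∃ k, i = k + 1 := ⟨i - 1, by omega⟩
      rw [h1, show 2 * (k + 1) + 1 - (k + 1) = k + 2 by omega]
      push_cast
      ring_nf
      nlinarith [(by positivity : (0 : ℝ) ≤ k), (by positivity : (0 : ℝ) ≤ (k : ℝ) ^ 2),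
        (by positivity : (0 : ℝ) ≤ (k : ℝ) ^ 3), (by positivity : (0 : ℝ) ≤ (k : ℝ) ^ 4)]
    · have h1' : (2 * h : ℝ) ≤ 4 * i := by exact_mod_cast h1
      exact add_pos_of_nonneg_of_pos (mul_nonneg (mul_nonneg (by linarith)
        (by linarith)) (by positivity)) hpos

lemma det_symbolMatrix_nonpos {h : ℕ} (h2 : 2 ≤ h) :
    (blockMatrix (symbolMatrix (2 * h + 1))).det.re ≤ 0 := by
  obtain ⟨r, hr, hdet⟩ := det_symbolMatrix_eq (2 * h + 1)
  obtain ⟨s, hs, hdet'⟩ := det_zeroBlock_neg h2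
  rw [hdet, hdet', ← Complex.ofReal_mul, Complex.ofReal_re]
  exact mul_nonpos_of_nonneg_of_nonpos hr hs.le

end ZeroBlock

section TwistorFibration

open Filter

/-- The unit sphere of `ℂ² × ℝ`. -/
def sphere4 : Set ((Fin 2 → ℂ) × ℝ) := {p | ‖p.1 0‖ ^ 2 + ‖p.1 1‖ ^ 2 + p.2 ^ 2 = 1}

lemma twistor_mem (g : CP3) :
    ((![2 * (gen 0 2 g + gen 3 1 g), 2 * (gen 1 2 g - gen 3 0 g)],
      (gen 0 0 g + gen 1 1 g - gen 2 2 g - gen 3 3 g).re) : (Fin 2 → ℂ) × ℝ) ∈ sphere4 := by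
  obtain ⟨g, z, hz, rfl⟩ := g
  simp only [Set.mem_ofPred_eq, Fin.sum_univ_four, ← Complex.normSq_eq_norm_sq,
    Complex.normSq_apply] at hz
  simp [sphere4, gen, ← Complex.normSq_eq_norm_sq, Complex.normSq_apply]
  linear_combination ((z 0).re * (z 0).re + (z 0).im * (z 0).im +
    ((z 1).re * (z 1).re + (z 1).im * (z 1).im) + ((z 2).re * (z 2).re + (z 2).im * (z 2).im) +
    ((z 3).re * (z 3).re + (z 3).im * (z 3).im) + 1) * hz

/-- The twistor fibration from projective 3-space to the 4-sphere. -/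
def twistor : C(CP3, sphere4) where
  toFun g := ⟨_, twistor_mem g⟩
  continuous_toFun := by
    refine Continuous.subtype_mk (Continuous.prodMk (continuous_pi fun i => ?_) ?_) _
    · fin_cases i
      · change Continuous fun g => 2 * (gen 0 2 g + gen 3 1 g)
        fun_prop
      · change Continuous fun g => 2 * (gen 1 2 g - gen 3 0 g)
        fun_prop
    · exact Complex.continuous_re.comp (by fun_prop)

lemma twistor_toCP3_quatJ (z : Fin 4 → ℂ) :
    twistor (toCP3 (quatJ z)) = twistor (toCP3 z) := by
  by_cases hz : z = 0
  · subst hz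
    congr 2
    funext i
    fin_cases i <;> simp [quatJ]
  have hz' : quatJ z ≠ 0 := fun h => hz (by
    funext i
    have h0 := congrFun h 0
    have h1 := congrFun h 1
    have h2 := congrFun h 2
    have h3 := congrFun h 3
    simp [quatJ] at h0 h1 h2 h3
    fin_cases i <;> assumption)
  have hn : ∑ k, ‖quatJ z k‖ ^ 2 = ∑ k, ‖z k‖ ^ 2 := by
    simp [Fin.sum_univ_four, quatJ]; ring
  refine Subtype.ext (Prod.ext (funext fun i => ?_) ?_)
  · simp only [twistor, ContinuousMap.coe_mk, toCP3, dif_neg hz, dif_neg hz', gen, hn]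
    fin_cases i <;> simp [quatJ] <;> ring
  · simp only [twistor, ContinuousMap.coe_mk, toCP3, dif_neg hz, dif_neg hz', gen, hn]
    congr 1
    simp [quatJ]; ring

/-- Matrices representing quaternions. -/
def IsQuat (M : Matrix (Fin 2) (Fin 2) ℂ) : Prop := M 1 1 = conj (M 0 0) ∧ M 0 1 = -conj (M 1 0)

/-- The pullback of a family of matrices along the twistor fibration. -/
def twistorPull (F : C(I × sphere4, Matrix (Fin 2) (Fin 2) ℂ)) (k l : Fin 2) : C(ℝ, C(CP3, ℂ)) :=
  ContinuousMap.curry ⟨fun p => F (Set.projIcc 0 1 zero_le_one p.1, twistor p.2) k l, by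
    have : Continuous fun p : ℝ × CP3 => F (Set.projIcc 0 1 zero_le_one p.1, twistor p.2) := by
      fun_prop
    exact this.matrix_elem k l⟩

lemma twistorPull_apply (F : C(I × sphere4, Matrix (Fin 2) (Fin 2) ℂ)) (k l : Fin 2) (t : ℝ)
    (g : CP3) : twistorPull F k l t g = F (Set.projIcc 0 1 zero_le_one t, twistor g) k l := rfl

lemma quatBlock_twistorPull {F : C(I × sphere4, Matrix (Fin 2) (Fin 2) ℂ)}
    (hF : ∀ x, IsQuat (F x)) (t : ℝ) (n : ℕ) :
    QuatBlock fun k l => compress (monoFam n) (toeplitz (twistorPull F k l t)) := by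
  refine quatBlock_compress (F := fun k l => twistorPull F k l t) (fun z => ?_) fun z => ?_
  · simp only [twistorPull_apply, twistor_toCP3_quatJ, (hF _).1]
  · simp only [twistorPull_apply, twistor_toCP3_quatJ, (hF _).2]

/-- The inverse of a family of invertible matrices. -/
lemma exists_inv_family {F : C(I × sphere4, Matrix (Fin 2) (Fin 2) ℂ)} (hF : ∀ x, (F x).det ≠ 0) :
    ∃ F' : C(I × sphere4, Matrix (Fin 2) (Fin 2) ℂ), ∀ t m l,
      ∑ k, twistorPull F' m k t * twistorPull F k l t = if m = l then 1 else 0 := by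
  refine ⟨⟨fun x => (F x).det⁻¹ • (F x).adjugate, ?_⟩, fun t m l => ?_⟩
  · exact (F.continuous.matrix_det.inv₀ hF).smul F.continuous.matrix_adjugate
  · ext g
    set x : I × sphere4 := (Set.projIcc 0 1 zero_le_one t, twistor g)
    have h : ((F x).det⁻¹ • (F x).adjugate * F x) m l = (1 : Matrix (Fin 2) (Fin 2) ℂ) m l := by
      rw [Matrix.smul_mul, Matrix.adjugate_mul, smul_smul, inv_mul_cancel₀ (hF x), one_smul]
    rw [Matrix.mul_apply, Matrix.one_apply] at h
    simp only [ContinuousMap.coe_sum, Finset.sum_apply, ContinuousMap.mul_apply]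
    refine h.trans ?_
    split_ifs <;> rfl

lemma det_twistorPull_path {F : C(I × sphere4, Matrix (Fin 2) (Fin 2) ℂ)}
    (hF : ∀ x, IsQuat (F x)) (hF' : ∀ x, (F x).det ≠ 0) :
    ∀ᶠ n in atTop, 0 <
      (compressMatrix toeplitz monoFam (fun k l => twistorPull F k l 0) n).det.re *
      (compressMatrix toeplitz monoFam (fun k l => twistorPull F k l 1) n).det.re := by
  obtain ⟨G, hG⟩ := exists_inv_family hF'
  exact det_compressMatrix_path (F := fun t k l => twistorPull F k l t)
    (F' := fun t k l => twistorPull G k l t) (fun g => norm_mulOp_le measurable_toCP3 g)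
    monoFam_orthogonal monoFam_ne_zero quantizes_compress_toeplitz
    (fun k l => (twistorPull F k l).continuous) (fun k l => (twistorPull G k l).continuous)
    (fun t _ => hG t) fun t _ n => (quatBlock_twistorPull hF t n).det_im

lemma det_twistorPull_symbol {F : C(I × sphere4, Matrix (Fin 2) (Fin 2) ℂ)}
    (hF : ∀ x, IsQuat (F x)) (hF' : ∀ x, (F x).det ≠ 0)
    (h0 : ∀ g k l, F (0, twistor g) k l = symbolPoly gen k l g) :
    ∀ᶠ n in atTop, 0 <
      (compressMatrix toeplitz monoFam (fun k l => twistorPull F k l 0) n).det.re *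
      (blockMatrix (symbolMatrix n)).det.re := by
  obtain ⟨G, hG⟩ := exists_inv_family hF'
  have h : ∀ k l, twistorPull F k l 0 = symbolPoly gen k l := fun k l => by
    ext g
    rw [twistorPull_apply, ← h0, Set.projIcc_left]
    rfl
  refine det_compressMatrix_symbol (F := fun k l => twistorPull F k l 0)
    (F' := fun k l => twistorPull G k l 0) monoFam_orthogonal monoFam_ne_zero (hG 0)
    (fun k l => ?_) fun s _ n => ?_
  · rw [h]; exact quantizes_symbolMatrix k l
  · exact ((quatBlock_twistorPull hF 0 n).convex (quatBlock_symbolMatrix n) (1 - s) s).det_im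

lemma compressMatrix_one {F : C(I × sphere4, Matrix (Fin 2) (Fin 2) ℂ)} (h1 : ∀ y, F (1, y) = 1)
    (n : ℕ) : compressMatrix toeplitz monoFam (fun k l => twistorPull F k l 1) n = 1 := by
  have h : ∀ k l, twistorPull F k l 1 = if k = l then 1 else 0 := fun k l => by
    ext g
    rw [twistorPull_apply, Set.projIcc_right]
    refine (congrFun₂ (h1 (twistor g)) k l).trans ?_
    rw [Matrix.one_apply]
    split_ifs <;> rfl
  ext ⟨k, a⟩ ⟨l, b⟩
  simp only [compressMatrix, blockMatrix, compress, Matrix.of_apply, h]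
  by_cases hkl : k = l
  · subst hkl
    rw [if_pos rfl, map_one]
    change inner ℂ (monoFam n a) (monoFam n b) / _ = _
    by_cases hab : a = b
    · subst hab
      have := monoFam_ne_zero n a
      rw [inner_self_eq_norm_sq_to_K, Matrix.one_apply_eq]
      push_cast
      exact div_self (by simpa using this)
    · rw [monoFam_orthogonal n a b hab, zero_div, Matrix.one_apply_ne (by simp [hab])]
  · rw [if_neg hkl, map_zero, Matrix.one_apply_ne (by simp [hkl])]
    simp

/-- The symbol is not homotopic to the identity through quaternionic matrices. -/
lemma not_exists_quat_homotopy {F G : C(I × sphere4, Matrix (Fin 2) (Fin 2) ℂ)}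
    (hF : ∀ x, IsQuat (F x)) (hF' : ∀ x, (F x).det ≠ 0)
    (hG : ∀ x, IsQuat (G x)) (hG' : ∀ x, (G x).det ≠ 0)
    (h0 : ∀ g k l, F (0, twistor g) k l = symbolPoly gen k l g)
    (hFG : ∀ y, F (1, y) = G (0, y)) (h1 : ∀ y, G (1, y) = 1) : False := by
  have hmid : ∀ k l, twistorPull F k l 1 = twistorPull G k l 0 := fun k l => by
    ext g
    rw [twistorPull_apply, twistorPull_apply, Set.projIcc_left, Set.projIcc_right]
    exact congrFun₂ (hFG _) k l
  obtain ⟨n, hn⟩ := eventually_atTop.1 ((det_twistorPull_symbol hF hF' h0).and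
    ((det_twistorPull_path hF hF').and (det_twistorPull_path hG hG')))
  obtain ⟨ha, hb, hc⟩ := hn (2 * (n + 2) + 1) (by omega)
  rw [compressMatrix_one h1, Matrix.det_one, Complex.one_re, mul_one] at hc
  simp only [hmid] at hb
  have hb' := (pos_iff_pos_of_mul_pos hb).2 hc
  exact absurd ((pos_iff_pos_of_mul_pos ha).1 hb') (det_symbolMatrix_nonpos (by omega)).not_gt

end TwistorFibration

section Clifford

/-- The quaternionic part of the matrix `U0mat v r`. -/
def quatPart (v : Fin 2 → ℂ) (r : ℝ) : Matrix (Fin 2) (Fin 2) ℂ :=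
  !![2 * r + Complex.I * (v 0 * conj (v 0) - v 1 * conj (v 1)), Complex.I * (2 * v 0 * conj (v 1));
    Complex.I * (2 * v 1 * conj (v 0)), 2 * r - Complex.I * (v 0 * conj (v 0) - v 1 * conj (v 1))]

/-- The scalar part of the matrix `U0mat v r`. -/
def phase (r : ℝ) : ℂ := Complex.I / (1 + Complex.I * r) ^ 2

lemma one_add_I_mul_ne_zero (r : ℝ) : (1 + Complex.I * r : ℂ) ≠ 0 := fun h => by
  simpa using congrArg Complex.re h

lemma continuous_phase : Continuous phase := by
  unfold phase
  exact continuous_const.div (by fun_prop) fun r => pow_ne_zero 2 (one_add_I_mul_ne_zero r)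

lemma phase_eq (r : ℝ) :
    phase r = (2 * r + Complex.I * (1 - r ^ 2)) / ((1 + r ^ 2) ^ 2 : ℝ) := by
  have h := one_add_I_mul_ne_zero r
  have h' : ((1 + r ^ 2 : ℝ) : ℂ) ≠ 0 := Complex.ofReal_ne_zero.2 (by positivity)
  push_cast at h' ⊢
  rw [phase, div_eq_div_iff (pow_ne_zero 2 h) (pow_ne_zero 2 h')]
  linear_combination (-2 * r - Complex.I * r ^ 2 * (1 - r ^ 2)) * Complex.I_sq

lemma phase_re (r : ℝ) : (phase r).re = 2 * r / (1 + r ^ 2) ^ 2 := by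
  rw [phase_eq, Complex.div_ofReal_re]; simp [← Complex.ofReal_pow]

lemma phase_im (r : ℝ) : (phase r).im = (1 - r ^ 2) / (1 + r ^ 2) ^ 2 := by
  rw [phase_eq, Complex.div_ofReal_im]; simp [← Complex.ofReal_pow]

lemma conj_phase_mul_phase (r : ℝ) : conj (phase r) * phase r * ((1 + r ^ 2) ^ 2 : ℝ) = 1 := by
  rw [mul_comm (conj _), Complex.mul_conj, Complex.normSq_apply, phase_re, phase_im,
    ← Complex.ofReal_mul, Complex.ofReal_eq_one]
  field_simp
  ring

lemma mem_sphere4_iff {v : Fin 2 → ℂ} {r : ℝ} :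
    (v, r) ∈ sphere4 ↔ v 0 * conj (v 0) + v 1 * conj (v 1) + r ^ 2 = 1 := by
  simp only [Complex.mul_conj, Complex.normSq_eq_norm_sq]
  exact_mod_cast Iff.rfl

lemma U0mat_eq {v : Fin 2 → ℂ} {r : ℝ} (h : (v, r) ∈ sphere4) :
    U0mat v r = phase r • quatPart v r := by
  rw [mem_sphere4_iff] at h
  have h0 := one_add_I_mul_ne_zero r
  ext i j
  fin_cases i <;> fin_cases j <;> simp [U0mat, quatPart, phase] <;> field_simp
  · linear_combination -h + (r ^ 2 - v 0 * conj (v 0) + v 1 * conj (v 1)) * Complex.I_sq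
  · linear_combination -v 0 * conj (v 1) * Complex.I_sq
  · linear_combination -v 1 * conj (v 0) * Complex.I_sq
  · linear_combination -h + (r ^ 2 + v 0 * conj (v 0) - v 1 * conj (v 1)) * Complex.I_sq

lemma det_quatPart {v : Fin 2 → ℂ} {r : ℝ} (h : (v, r) ∈ sphere4) :
    (quatPart v r).det = ((1 + r ^ 2) ^ 2 : ℝ) := by
  rw [mem_sphere4_iff] at h
  rw [quatPart, Matrix.det_fin_two_of]
  push_cast
  linear_combination (v 0 * conj (v 0) + v 1 * conj (v 1) + 1 - r ^ 2) * h -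
    (v 0 * conj (v 0) + v 1 * conj (v 1)) ^ 2 * Complex.I_sq

/-- The path of scalars from `i` to `phase r`. -/
def phasePath (s r : ℝ) : ℂ := (1 - s) * Complex.I + s * phase r

lemma phasePath_ne_zero {s r : ℝ} (hs : 0 ≤ s) (hs' : s ≤ 1) (hr : r ^ 2 ≤ 1) :
    phasePath s r ≠ 0 := fun h => by
  have hre := congrArg Complex.re h
  have him := congrArg Complex.im h
  simp [phasePath, phase_re, phase_im] at hre him
  rcases hre with rfl | rfl | hre
  · simp at him
  · norm_num at him
  · nlinarith

/-- Rescaling the rows of the quaternionic part. -/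
def scaledQuat (c : ℂ) (v : Fin 2 → ℂ) (r : ℝ) : Matrix (Fin 2) (Fin 2) ℂ :=
  Matrix.of ![conj c • quatPart v r 0, c • quatPart v r 1]

lemma isQuat_scaledQuat (c : ℂ) (v : Fin 2 → ℂ) (r : ℝ) : IsQuat (scaledQuat c v r) := by
  have h2 : conj (2 : ℂ) = 2 := map_ofNat _ 2
  constructor <;> simp [scaledQuat, quatPart, h2] <;> left <;> ring

lemma det_scaledQuat (c : ℂ) (v : Fin 2 → ℂ) (r : ℝ) :
    (scaledQuat c v r).det = conj c * c * (quatPart v r).det := by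
  simp [scaledQuat, Matrix.det_fin_two]; ring

lemma scaledQuat_twistor (g : CP3) (k l : Fin 2) :
    scaledQuat Complex.I (twistor g).1.1 (twistor g).1.2 k l = symbolPoly gen k l g := by
  obtain ⟨g, z, hz, rfl⟩ := g
  have hr : ∀ i : Fin 4, z i * conj (z i) = ((Complex.normSq (z i) : ℝ) : ℂ) :=
    fun i => Complex.mul_conj _
  have h2 : conj (2 : ℂ) = 2 := map_ofNat _ 2
  fin_cases k <;> fin_cases l <;>
    simp [scaledQuat, quatPart, twistor, symbolPoly, gen, Complex.mul_conj]
  all_goals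
    simp only [← hr, h2]
    ring_nf
    simp only [Complex.I_sq]
    ring

/-- Multiplying the first row of a matrix by the conjugate of its determinant. -/
def toSU (U : Matrix (Fin 2) (Fin 2) ℂ) : Matrix (Fin 2) (Fin 2) ℂ :=
  Matrix.of ![conj U.det • U 0, U 1]

lemma continuous_toSU : Continuous toSU := by
  refine continuous_matrix fun i j => ?_
  fin_cases i <;> simp [toSU, Matrix.det_fin_two] <;> fun_prop

lemma conj_det_mul_det {U : Matrix (Fin 2) (Fin 2) ℂ} (h : U ∈ Matrix.unitaryGroup (Fin 2) ℂ) :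
    conj U.det * U.det = 1 := by
  have := Matrix.det_of_mem_unitary h
  exact Unitary.star_mul_self_of_mem this

lemma det_toSU {U : Matrix (Fin 2) (Fin 2) ℂ} (h : U ∈ Matrix.unitaryGroup (Fin 2) ℂ) :
    (toSU U).det = 1 := by
  rw [← conj_det_mul_det h, Matrix.det_fin_two, Matrix.det_fin_two U]
  simp [toSU, Matrix.det_fin_two]
  ring

lemma isQuat_toSU {U : Matrix (Fin 2) (Fin 2) ℂ} (h : U ∈ Matrix.unitaryGroup (Fin 2) ℂ) :
    IsQuat (toSU U) := by
  have hd := conj_det_mul_det h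
  have hadj : U.adjugate = U.det • star U := by
    have h1 := Matrix.mem_unitaryGroup_iff.1 h
    calc U.adjugate = U.adjugate * (U * star U) := by rw [h1, mul_one]
      _ = _ := by rw [← mul_assoc, Matrix.adjugate_mul, Matrix.smul_mul, one_mul]
  have h0 := congrFun₂ hadj 0 0
  have h1 := congrFun₂ hadj 0 1
  simp [Matrix.adjugate_fin_two, Matrix.star_apply] at h0 h1
  constructor
  · simpa [toSU] using h0
  · simp only [toSU, Matrix.of_apply, Matrix.cons_val_zero, Matrix.cons_val_one,
      Pi.smul_apply, smul_eq_mul]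
    linear_combination -conj U.det * h1 - conj (U 1 0) * hd

lemma toSU_U0mat {v : Fin 2 → ℂ} {r : ℝ} (h : (v, r) ∈ sphere4) :
    toSU (U0mat v r) = scaledQuat (phase r) v r := by
  have h1 := conj_phase_mul_phase r
  have hd : conj (U0mat v r).det * phase r = conj (phase r) := by
    rw [U0mat_eq h, Matrix.det_smul, det_quatPart h]
    simp only [Fintype.card_fin, map_mul, map_pow, Complex.conj_ofReal]
    linear_combination conj (phase r) * h1
  ext i j
  fin_cases i
  · have : conj (U0mat v r).det * U0mat v r 0 j = conj (phase r) * quatPart v r 0 j := by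
      conv_lhs => arg 2; rw [U0mat_eq h]
      rw [Matrix.smul_apply, smul_eq_mul, ← mul_assoc, hd]
    simpa [toSU, scaledQuat] using this
  · simp [toSU, scaledQuat, U0mat_eq h]

/-- The clutching map is not null-homotopic on the sphere. -/
lemma not_exists_unitary_homotopy_sphere4 {h : C(I × sphere4, Matrix (Fin 2) (Fin 2) ℂ)}
    (hU : ∀ x, h x ∈ Matrix.unitaryGroup (Fin 2) ℂ)
    (h0 : ∀ y : sphere4, h (0, y) = U0mat y.1.1 y.1.2) (h1 : ∀ y, h (1, y) = 1) : False := by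
  have hsq (y : sphere4) : y.1.2 ^ 2 ≤ 1 := by
    have : ‖y.1.1 0‖ ^ 2 + ‖y.1.1 1‖ ^ 2 + y.1.2 ^ 2 = 1 := y.2
    nlinarith [sq_nonneg ‖y.1.1 0‖, sq_nonneg ‖y.1.1 1‖]
  let F : C(I × sphere4, Matrix (Fin 2) (Fin 2) ℂ) :=
    ⟨fun x => scaledQuat (phasePath x.1 x.2.1.2) x.2.1.1 x.2.1.2, by
      have hp : Continuous fun x : I × sphere4 => phasePath x.1 x.2.1.2 := by
        have := continuous_phase
        unfold phasePath
        fun_prop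
      refine continuous_matrix fun i j => ?_
      fin_cases i <;> fin_cases j <;> simp [scaledQuat, quatPart] <;> fun_prop⟩
  let G : C(I × sphere4, Matrix (Fin 2) (Fin 2) ℂ) :=
    ⟨fun x => toSU (h x), continuous_toSU.comp h.continuous⟩
  refine not_exists_quat_homotopy (F := F) (G := G) (fun x => isQuat_scaledQuat _ _ _)
    (fun x => ?_) (fun x => isQuat_toSU (hU x)) (fun x => ?_) (fun g k l => ?_)
    (fun y => ?_) fun y => ?_
  · change (scaledQuat _ _ _).det ≠ 0
    have hne := phasePath_ne_zero x.1.2.1 x.1.2.2 (hsq x.2)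
    rw [det_scaledQuat, det_quatPart x.2.2]
    refine mul_ne_zero (mul_ne_zero ?_ hne) (Complex.ofReal_ne_zero.2 (by positivity))
    simpa using hne
  · change (toSU _).det ≠ 0
    rw [det_toSU (hU x)]
    exact one_ne_zero
  · rw [← scaledQuat_twistor]
    simp [F, phasePath]
  · change scaledQuat (phasePath (1 : I) _) _ _ = toSU _
    rw [h0, toSU_U0mat y.2]
    simp [phasePath]
  · change toSU _ = _
    rw [h1]
    ext i j
    fin_cases i <;> fin_cases j <;> simp [toSU]

end Clifford

section Pinch

lemma exists_qmap (x : Torus4) : ∃ u : Fin 4 → ℝ, (∀ i, u i ∈ Set.Ioc (-1 : ℝ) 1) ∧ qmap u = x := by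
  have : Fact (0 < (2 : ℝ)) := ⟨two_pos⟩
  have h (i) : ∃ a ∈ Set.Ioc (-1 : ℝ) 1, (a : AddCircle (2 : ℝ)) = x i := by
    obtain ⟨⟨a, ha⟩, h⟩ := (AddCircle.equivIoc 2 (-1 : ℝ)).symm.surjective (x i)
    exact ⟨a, by norm_num at ha; exact ha, h⟩
  choose u hu hx using h
  exact ⟨u, hu, funext hx⟩

lemma coe_eq_coe_one {a : ℝ} (ha : a ∈ Set.Ioc (-1 : ℝ) 1) :
    (a : AddCircle (2 : ℝ)) = ((1 : ℝ) : AddCircle (2 : ℝ)) ↔ a = 1 := by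
  have : Fact (0 < (2 : ℝ)) := ⟨two_pos⟩
  refine ⟨fun h => ?_, fun h => by rw [h]⟩
  refine (AddCircle.coe_eq_coe_iff_of_mem_Ioc (a := -1) ?_ ?_).1 h
  · norm_num; exact ha
  · norm_num

lemma abs_le_one_of_mem_Ioc {u : Fin 4 → ℝ} (hu : ∀ i, u i ∈ Set.Ioc (-1 : ℝ) 1) (i : Fin 4) :
    |u i| ≤ 1 := abs_le.2 ⟨(hu i).1.le, (hu i).2⟩

lemma normSq_toC2 (u : Fin 4 → ℝ) : ‖toC2 u 0‖ ^ 2 + ‖toC2 u 1‖ ^ 2 = ∑ i, u i ^ 2 := by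
  simp [toC2, ← Complex.normSq_eq_norm_sq, Complex.normSq_apply, Fin.sum_univ_four]
  ring

lemma toC2_smul (a : ℝ) (u : Fin 4 → ℝ) (j : Fin 2) : toC2 (a • u) j = a • toC2 u j := by
  fin_cases j <;> simp [toC2] <;> ring

lemma toC2_injective : Function.Injective toC2 := fun u w h => by
  have h0 := congrFun h 0
  have h1 := congrFun h 1
  simp only [toC2, Matrix.cons_val_zero, Matrix.cons_val_one, Complex.ext_iff] at h0 h1
  simp at h0 h1
  funext i
  fin_cases i
  exacts [h0.1, h0.2, h1.1, h1.2]

/-- The Euclidean sphere map of the cube collapsing its boundary. -/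
def cubeMap (u : Fin 4 → ℝ) : (Fin 2 → ℂ) × ℝ :=
  (fun j => ((Real.sqrt (∑ i, u i ^ 2))⁻¹ * Real.sin (Real.pi * ‖u‖) : ℝ) • toC2 u j,
    Real.cos (Real.pi * ‖u‖))

lemma sum_sq_pos {u : Fin 4 → ℝ} (hu : u ≠ 0) : 0 < ∑ i, u i ^ 2 := by
  obtain ⟨i, hi⟩ := Function.ne_iff.1 hu
  exact Finset.sum_pos' (fun _ _ => sq_nonneg _)
    ⟨i, Finset.mem_univ i, by simpa using sq_pos_of_ne_zero hi⟩

lemma cubeMap_mem (u : Fin 4 → ℝ) : cubeMap u ∈ sphere4 := by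
  rcases eq_or_ne u 0 with rfl | hu
  · simp [cubeMap, sphere4]
  have h := sum_sq_pos hu
  change ‖_ • toC2 u 0‖ ^ 2 + ‖_ • toC2 u 1‖ ^ 2 + Real.cos _ ^ 2 = 1
  rw [norm_smul, norm_smul, mul_pow, mul_pow, ← mul_add, normSq_toC2, Real.norm_eq_abs, sq_abs,
    mul_pow, inv_pow, Real.sq_sqrt h.le, mul_right_comm, inv_mul_cancel₀ h.ne', one_mul,
    Real.sin_sq_add_cos_sq]

lemma cubeMap_boundary {u : Fin 4 → ℝ} (hu : ‖u‖ = 1) : cubeMap u = (0, -1) := by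
  simp [cubeMap, hu]; rfl

lemma norm_le_one_of_mem_Ioc {u : Fin 4 → ℝ} (hu : ∀ i, u i ∈ Set.Ioc (-1 : ℝ) 1) : ‖u‖ ≤ 1 :=
  (pi_norm_le_iff_of_nonneg zero_le_one).2 (abs_le_one_of_mem_Ioc hu)

lemma norm_eq_one_iff_of_mem_Ioc {u : Fin 4 → ℝ} (hu : ∀ i, u i ∈ Set.Ioc (-1 : ℝ) 1)
    {j : Fin 4} (hj : u j = 1) : ‖u‖ = 1 := by
  refine le_antisymm (norm_le_one_of_mem_Ioc hu) ?_
  have := norm_le_pi_norm u j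
  rwa [hj, norm_one] at this

lemma exists_coe_eq_of_norm_eq_one {u : Fin 4 → ℝ} (hu : ‖u‖ = 1) :
    ∃ j, qmap u j = ((1 : ℝ) : AddCircle (2 : ℝ)) := by
  by_contra! h
  refine hu.not_lt ((pi_norm_lt_iff zero_lt_one).2 fun j => abs_lt.2 ?_)
  have hj := abs_le.1 ((norm_le_pi_norm u j).trans hu.le)
  refine ⟨lt_of_le_of_ne hj.1 fun h1 => h j ?_,
    lt_of_le_of_ne hj.2 fun h1 => h j (by rw [qmap, h1])⟩
  rw [qmap, ← h1, ← AddCircle.coe_add_period]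
  norm_num

lemma cubeMap_injective {u w : Fin 4 → ℝ} (hu : ‖u‖ ≤ 1) (hw : ‖w‖ ≤ 1)
    (h : cubeMap u = cubeMap w) : u = w ∨ ‖u‖ = 1 ∧ ‖w‖ = 1 := by
  have hpi := Real.pi_pos
  have hn : ‖u‖ = ‖w‖ := by
    have := Real.injOn_cos ⟨by positivity, by nlinarith⟩ ⟨by positivity, by nlinarith⟩
      (congrArg Prod.snd h)
    exact mul_left_cancel₀ hpi.ne' this
  by_cases h1 : ‖u‖ = 1
  · exact Or.inr ⟨h1, hn ▸ h1⟩
  left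
  by_cases h0 : u = 0
  · rw [h0, norm_zero] at hn
    rw [h0, norm_eq_zero.1 hn.symm]
  have h0' : w ≠ 0 := fun hw => h0 (by rwa [hw, norm_zero, norm_eq_zero] at hn)
  have hs : 0 < Real.sin (Real.pi * ‖u‖) :=
    Real.sin_pos_of_pos_of_lt_pi (mul_pos hpi (norm_pos_iff.2 h0))
      (by nlinarith [lt_of_le_of_ne hu h1])
  have ha := mul_pos (inv_pos.2 (Real.sqrt_pos.2 (sum_sq_pos h0))) hs
  have hb := mul_pos (inv_pos.2 (Real.sqrt_pos.2 (sum_sq_pos h0'))) (hn ▸ hs)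
  have hv : ((√(∑ i, u i ^ 2))⁻¹ * Real.sin (Real.pi * ‖u‖)) • u =
      ((√(∑ i, w i ^ 2))⁻¹ * Real.sin (Real.pi * ‖w‖)) • w := by
    refine toC2_injective (funext fun j => ?_)
    rw [toC2_smul, toC2_smul]
    exact congrFun (congrArg Prod.fst h) j
  have hab := congrArg norm hv
  rw [norm_smul, norm_smul, Real.norm_of_nonneg ha.le, Real.norm_of_nonneg hb.le, ← hn] at hab
  rw [hn] at hab ha hv
  have := mul_right_cancel₀ (norm_ne_zero_iff.2 h0') hab
  rw [this] at hv
  exact smul_right_injective _ hb.ne' hv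

lemma cubeMap_surjective {y : (Fin 2 → ℂ) × ℝ} (hy : y ∈ sphere4) :
    ∃ u, ‖u‖ ≤ 1 ∧ cubeMap u = y := by
  obtain ⟨v, r⟩ := y
  have hy' : ‖v 0‖ ^ 2 + ‖v 1‖ ^ 2 + r ^ 2 = 1 := hy
  obtain ⟨w, rfl⟩ : ∃ w, toC2 w = v := ⟨![(v 0).re, (v 0).im, (v 1).re, (v 1).im], by
    funext j; fin_cases j <;> simp [toC2]⟩
  rw [normSq_toC2] at hy'
  rcases eq_or_ne w 0 with rfl | hw
  · have : r = 1 ∨ r = -1 := sq_eq_one_iff.1 (by simpa using hy')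
    have h0 : toC2 0 = 0 := by funext j; fin_cases j <;> simp [toC2]
    rw [h0]
    rcases this with rfl | rfl
    · refine ⟨0, by simp, ?_⟩
      simp [cubeMap, h0]; rfl
    · exact ⟨fun _ => 1, by simp, cubeMap_boundary (by simp)⟩
  have hS := sum_sq_pos hw
  have hn := norm_pos_iff.2 hw
  have hpi := Real.pi_pos
  have hr : r < 1 := by nlinarith
  have hr' : -1 ≤ r := by nlinarith
  have hc : 0 < Real.arccos r := Real.arccos_pos.2 hr
  set c := Real.arccos r / Real.pi / ‖w‖ with hcdef
  have hc0 : 0 < c := by positivity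
  have hcw : ‖c • w‖ = Real.arccos r / Real.pi := by
    rw [norm_smul, Real.norm_of_nonneg hc0.le, hcdef, div_mul_cancel₀ _ hn.ne']
  have hpic : Real.pi * ‖c • w‖ = Real.arccos r := by rw [hcw, mul_div_cancel₀ _ hpi.ne']
  refine ⟨c • w, ?_, ?_⟩
  · rw [hcw, div_le_one hpi]; exact Real.arccos_le_pi r
  have hsum : ∑ i, (c • w) i ^ 2 = c ^ 2 * ∑ i, w i ^ 2 := by
    simp [mul_pow, Finset.mul_sum]
  have hsqrt : √(∑ i, (c • w) i ^ 2) = c * √(∑ i, w i ^ 2) := by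
    rw [hsum, Real.sqrt_mul (sq_nonneg c), Real.sqrt_sq hc0.le]
  refine Prod.ext (funext fun j => ?_) ?_
  · change ((√(∑ i, (c • w) i ^ 2))⁻¹ * Real.sin (Real.pi * ‖c • w‖)) • toC2 (c • w) j = _
    rw [hpic, Real.sin_arccos, hsqrt, toC2_smul, smul_smul,
      show 1 - r ^ 2 = ∑ i, w i ^ 2 by linarith]
    have := (Real.sqrt_pos.2 hS).ne'
    convert one_smul ℝ (toC2 w j)
    field_simp
  · change Real.cos (Real.pi * ‖c • w‖) = r
    rw [hpic, Real.cos_arccos hr' hr.le]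

/-- A null-homotopy may be corrected to be trivial on given faces of the torus. -/
lemma exists_homotopy_faces {V : Torus4 → Matrix (Fin 2) (Fin 2) ℂ}
    (hV : ∀ x : Torus4, (∃ j, x j = ((1 : ℝ) : AddCircle (2 : ℝ))) → V x = 1)
    {H : C(I × Torus4, Matrix (Fin 2) (Fin 2) ℂ)}
    (hU : ∀ p, H p ∈ Matrix.unitaryGroup (Fin 2) ℂ) (h0 : ∀ x, H (0, x) = V x)
    (h1 : ∃ c, ∀ x, H (1, x) = c) (s : Finset (Fin 4)) :
    ∃ h : C(I × Torus4, Matrix (Fin 2) (Fin 2) ℂ),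
      (∀ p, h p ∈ Matrix.unitaryGroup (Fin 2) ℂ) ∧ (∀ x, h (0, x) = V x) ∧
      (∃ c, ∀ x, h (1, x) = c) ∧
      ∀ j ∈ s, ∀ t x, x j = ((1 : ℝ) : AddCircle (2 : ℝ)) → h (t, x) = 1 := by
  induction s using Finset.induction_on with
  | empty => exact ⟨H, hU, h0, h1, by simp⟩
  | insert j s _ ih =>
    obtain ⟨h, hU, h0, ⟨c, hc⟩, hs⟩ := ih
    refine ⟨⟨fun p => h p * star (h (p.1, Function.update p.2 j ((1 : ℝ) : AddCircle (2 : ℝ)))),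
      ?_⟩, fun p => mul_mem (hU p) (Unitary.star_mem (hU _)), fun x => ?_,
      ⟨c * star c, fun x => ?_⟩, ?_⟩
    · have : Continuous fun p : I × Torus4 =>
          h (p.1, Function.update p.2 j ((1 : ℝ) : AddCircle (2 : ℝ))) :=
        h.continuous.comp (continuous_fst.prodMk (continuous_snd.update j continuous_const))
      exact h.continuous.mul this.matrix_conjTranspose
    · change h (0, x) * star (h (0, _)) = _
      rw [h0, h0, hV (Function.update _ _ _) ⟨j, by simp⟩, star_one, mul_one]
    · change h (1, x) * star (h (1, _)) = _
      rw [hc, hc]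
    · intro k hk t x hx
      change h (t, x) * star (h (t, _)) = 1
      by_cases hkj : k = j
      · subst hkj
        rw [← hx, Function.update_eq_self]
        exact Matrix.mem_unitaryGroup_iff.1 (hU _)
      · have hk' := (Finset.mem_insert.1 hk).resolve_left hkj
        rw [hs k hk' t x hx, hs k hk' t _ (by rwa [Function.update_of_ne hkj]), star_one,
          mul_one]

lemma U0mat_zero (r : ℝ) : U0mat 0 r = 1 := by
  ext i j
  simp [U0mat, Matrix.one_apply]

end Pinch

/-- Let `P : 𝕋⁴ → S⁴ ⊂ ℂ² × ℝ` be the continuous pinch map, determined by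
`P(π u) = (u ‖u‖₂⁻¹ sin(π ‖u‖_∞), cos(π ‖u‖_∞))` for `u ∈ [−1,1]⁴`, `u ≠ 0`, and
`P(π 0) = (0, 1)` (here `‖u‖` denotes the supremum norm of `u : Fin 4 → ℝ`).
Then the continuous map `V_0 = U_0 ∘ P : 𝕋⁴ → U(2)` is not homotopic, through
continuous maps from `𝕋⁴` into the unitary group `U(2)`, to any constant map. -/
theorem V0_not_nullhomotopic (P : Torus4 → (Fin 2 → ℂ) × ℝ) (hPcont : Continuous P)
    (hP0 : P (qmap 0) = (fun _ => 0, 1))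
    (hP : ∀ u : Fin 4 → ℝ, (∀ i, |u i| ≤ 1) → u ≠ 0 →
      P (qmap u) =
        (fun j => (((Real.sqrt (∑ i, u i ^ 2))⁻¹ * Real.sin (Real.pi * ‖u‖) : ℝ)) • toC2 u j,
          Real.cos (Real.pi * ‖u‖))) :
    ¬ ∃ H : C(I × Torus4, Matrix (Fin 2) (Fin 2) ℂ),
        (∀ (t : I) (x : Torus4), H (t, x) ∈ Matrix.unitaryGroup (Fin 2) ℂ) ∧
        (∀ x : Torus4, H (0, x) = U0mat (P x).1 (P x).2) ∧
        ∃ c : Matrix (Fin 2) (Fin 2) ℂ, ∀ x : Torus4, H (1, x) = c := by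
  rintro ⟨H, hU, h0, h1⟩
  have : Fact (0 < (2 : ℝ)) := ⟨two_pos⟩
  have hP' (u : Fin 4 → ℝ) (hu : ‖u‖ ≤ 1) : P (qmap u) = cubeMap u := by
    rcases eq_or_ne u 0 with rfl | hne
    · rw [hP0]; simp [cubeMap]
    · exact hP u (fun i => (norm_le_pi_norm u i).trans hu) hne
  have hbd (x : Torus4) (hx : ∃ j, x j = ((1 : ℝ) : AddCircle (2 : ℝ))) : P x = (0, -1) := by
    obtain ⟨u, hu, rfl⟩ := exists_qmap x
    obtain ⟨j, hj⟩ := hx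
    rw [hP' u (norm_le_one_of_mem_Ioc hu),
      cubeMap_boundary (norm_eq_one_iff_of_mem_Ioc hu ((coe_eq_coe_one (hu j)).1 hj))]
  obtain ⟨h, hU, h0, ⟨c, hc⟩, hface⟩ := exists_homotopy_faces
    (V := fun x => U0mat (P x).1 (P x).2) (fun x hx => by rw [hbd x hx]; exact U0mat_zero _)
    (fun p => hU p.1 p.2) h0 h1 Finset.univ
  have h1 (x) : h (1, x) = 1 := by
    rw [hc, ← hc fun _ => ((1 : ℝ) : AddCircle (2 : ℝ)), hface 0 (Finset.mem_univ _) _ _ rfl]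
  have hmem (x : Torus4) : P x ∈ sphere4 := by
    obtain ⟨u, hu, rfl⟩ := exists_qmap x
    rw [hP' u (norm_le_one_of_mem_Ioc hu)]
    exact cubeMap_mem u
  let q : C(I × Torus4, I × sphere4) :=
    ⟨fun p => (p.1, ⟨P p.2, hmem p.2⟩), by fun_prop⟩
  have hsurj : Function.Surjective q := fun ⟨t, y, hy⟩ => by
    obtain ⟨u, hu, rfl⟩ := cubeMap_surjective hy
    exact ⟨(t, qmap u), Prod.ext rfl (Subtype.ext (hP' u hu))⟩
  have hq : Topology.IsQuotientMap q := .of_surjective_continuous hsurj q.continuous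
  have hfac : Function.FactorsThrough h q := fun ⟨t, x⟩ ⟨t', x'⟩ hxx => by
    obtain rfl : t = t' := congrArg Prod.fst hxx
    have hPx : P x = P x' := congrArg (fun p => p.2.1) hxx
    obtain ⟨u, hu, rfl⟩ := exists_qmap x
    obtain ⟨w, hw, rfl⟩ := exists_qmap x'
    have hu := norm_le_one_of_mem_Ioc hu
    have hw := norm_le_one_of_mem_Ioc hw
    rw [hP' u hu, hP' w hw] at hPx
    rcases cubeMap_injective hu hw hPx with rfl | ⟨hu1, hw1⟩
    · rfl
    · obtain ⟨j, hj⟩ := exists_coe_eq_of_norm_eq_one hu1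
      obtain ⟨k, hk⟩ := exists_coe_eq_of_norm_eq_one hw1
      rw [hface j (Finset.mem_univ _) _ _ hj, hface k (Finset.mem_univ _) _ _ hk]
  have hlift (p) : hq.lift h hfac (q p) = h p := DFunLike.congr_fun (hq.lift_comp h hfac) p
  refine not_exists_unitary_homotopy_sphere4 (h := hq.lift h hfac) (fun y => ?_) (fun y => ?_)
    fun y => ?_
  · obtain ⟨p, rfl⟩ := hsurj y
    rw [hlift]
    exact hU p
  · obtain ⟨⟨t, x⟩, hx⟩ := hsurj (0, y)
    obtain rfl : t = 0 := congrArg Prod.fst hx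
    obtain rfl : (q (0, x)).2 = y := congrArg Prod.snd hx
    rw [← hx, hlift, h0]
    rfl
  · obtain ⟨⟨t, x⟩, hx⟩ := hsurj (1, y)
    obtain rfl : t = 1 := congrArg Prod.fst hx
    rw [← hx, hlift, h1]
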